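/- arXiv:0711.1068 — 4 statements merged into one kernel-verified Lean document; each statement's English description precedes it below -/
import Mathlib

section
/- Let X be a continuous centered Gaussian process on [0,1] with covariance q, let λ, μ be finite signed measures on [0,1] satisfying ⟨Qλ,μ⟩ = 0 and ⟨Qλ,λ⟩ + ⟨Qμ,μ⟩ = 1, with I := ⟨Qλ,λ⟩ < 1, and let κ ∈ ℝ. Define Y_t := X_t + (Λ_t + M_t)(κ − a(X) − γ(X)) and Z_t := X_t + (1−I)^{-1} M_t (κ − a(X) − γ(X)). Then for every bounded Borel function Φ : C([0,1]) → ℝ one has E[Φ(Y)] = E[Φ(Z) ρ(Z)], where ρ(ω) := (1−I)^{-1/2} exp( −(γ(ω) − κ)² / (2(1−I)) + κ²/2 ). -/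
open MeasureTheory ProbabilityTheory Set

/-- Integral of a real function against a finite signed measure, via the Jordan
decomposition. -/
noncomputable def sint {α : Type*} [MeasurableSpace α]
    (ν : MeasureTheory.SignedMeasure α) (f : α → ℝ) : ℝ :=
  (∫ x, f x ∂ν.toJordanDecomposition.posPart)
    - ∫ x, f x ∂ν.toJordanDecomposition.negPart

open Filter Topology

theorem map_eq_gaussianReal_zero_of_tendsto {Ω : Type*} [MeasurableSpace Ω] {P : Measure Ω}
    [IsProbabilityMeasure P] {f : ℕ → Ω → ℝ} {g : Ω → ℝ} (hf : ∀ n, Measurable (f n))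
    (hlim : ∀ ω, Tendsto (fun n => f n ω) atTop (𝓝 (g ω)))
    (hgauss : ∀ n, ∃ v : NNReal, P.map (f n) = gaussianReal 0 v) :
    ∃ v : NNReal, P.map g = gaussianReal 0 v := by
  choose v hv using hgauss
  have hg : Measurable g := measurable_of_tendsto_metrizable hf (tendsto_pi_nhds.2 hlim)
  have : IsProbabilityMeasure (P.map g) := Measure.isProbabilityMeasure_map hg.aemeasurable
  have hφ : ∀ t : ℝ, Tendsto (fun n => Complex.exp (-(v n : ℂ) * t ^ 2 / 2)) atTop
      (𝓝 (charFun (P.map g) t)) := by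
    intro t
    have h1 : ∀ n, Complex.exp (-(v n : ℂ) * t ^ 2 / 2)
        = ∫ ω, Complex.exp (t * f n ω * Complex.I) ∂P := by
      intro n
      rw [← integral_map (φ := f n) (f := fun y : ℝ => Complex.exp (t * y * Complex.I))
        (hf n).aemeasurable (by fun_prop), ← charFun_apply_real, hv n, charFun_gaussianReal]
      congr 1
      push_cast
      ring
    simp_rw [h1]
    rw [charFun_apply_real, integral_map hg.aemeasurable (by fun_prop)]
    refine tendsto_integral_of_dominated_convergence (fun _ => 1)
      (fun n => (by have := hf n; fun_prop : Measurable _).aestronglyMeasurable)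
      (integrable_const _) ?_ ?_
    · intro n
      filter_upwards with ω
      rw [← Complex.ofReal_mul, Complex.norm_exp_ofReal_mul_I]
    · filter_upwards with ω
      have hc : Continuous fun y : ℝ => Complex.exp (t * y * Complex.I) := by fun_prop
      exact (hc.tendsto _).comp (hlim ω)
  obtain ⟨t, ht0, ht⟩ : ∃ t : ℝ, t ≠ 0 ∧ charFun (P.map g) t ≠ 0 := by
    have h0 : charFun (P.map g) 0 ≠ 0 := by simp
    have h1 : ∀ᶠ t in 𝓝[≠] (0 : ℝ), charFun (P.map g) t ≠ 0 :=
      (continuous_charFun.continuousAt.eventually_ne h0).filter_mono nhdsWithin_le_nhds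
    obtain ⟨t, h⟩ := (h1.and self_mem_nhdsWithin).exists
    exact ⟨t, h.2, h.1⟩
  have hvlim : Tendsto (fun n => (v n : ℝ)) atTop
      (𝓝 (-2 / t ^ 2 * Real.log ‖charFun (P.map g) t‖)) := by
    have h1 := (((hφ t).norm).log (norm_ne_zero_iff.2 ht)).const_mul (-2 / t ^ 2)
    refine h1.congr fun n => ?_
    have : -(v n : ℂ) * t ^ 2 / 2 = ((-(v n : ℝ) * t ^ 2 / 2 : ℝ) : ℂ) := by push_cast; rfl
    rw [this, Complex.norm_exp, Complex.ofReal_re, Real.log_exp]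
    field_simp
  set c := -2 / t ^ 2 * Real.log ‖charFun (P.map g) t‖
  have hc : 0 ≤ c := ge_of_tendsto' hvlim fun n => (v n).2
  obtain ⟨w, hw⟩ : ∃ w : NNReal, (w : ℝ) = c := ⟨⟨c, hc⟩, rfl⟩
  refine ⟨w, Measure.ext_of_charFun (funext fun s => ?_)⟩
  refine tendsto_nhds_unique (hφ s) ?_
  rw [charFun_gaussianReal]
  have hcont : Continuous fun y : ℝ => Complex.exp (-(y : ℂ) * s ^ 2 / 2) := by fun_prop
  have h := (hcont.tendsto c).comp hvlim
  rw [← hw] at h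
  simpa [neg_div, Function.comp_def] using h

theorem integral_cexp_neg_half_quadratic {J : ℝ} (hJ : 0 < J) (c d : ℂ) :
    ∫ b : ℝ, Complex.exp (-(J / 2) * b ^ 2 + c * b + d)
      = Real.sqrt (2 * Real.pi) / Real.sqrt J * Complex.exp (d + c ^ 2 / (2 * J)) := by
  have hJ' : (J : ℂ) ≠ 0 := by exact_mod_cast hJ.ne'
  rw [integral_cexp_quadratic (by simpa using hJ)]
  congr 1
  · rw [← Complex.ofReal_div, ← Real.sqrt_div (by positivity), Real.sqrt_eq_rpow,
      Complex.ofReal_cpow (by positivity)]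
    push_cast
    congr 1
    field_simp
  · congr 1
    field_simp
    ring

theorem charFunDual_eq_of_centered {E : Type*} [NormedAddCommGroup E] [NormedSpace ℝ E]
    [CompleteSpace E] [SecondCountableTopology E] [MeasurableSpace E] [BorelSpace E]
    {ν : Measure E} [IsGaussian ν] (hν : ∀ L : StrongDual ℝ E, ∫ x, L x ∂ν = 0)
    (L : StrongDual ℝ E) :
    charFunDual ν L = Complex.exp (-(uncenteredCovarianceBilinDual ν L L : ℝ) / 2) := by
  rw [IsGaussian.charFunDual_eq, integral_complex_ofReal, hν,
    variance_of_integral_eq_zero (by fun_prop) (hν L),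
    uncenteredCovarianceBilinDual_apply IsGaussian.memLp_two_id]
  simp [pow_two, neg_div]

theorem map_add_smul_eq_map_withDensity {E : Type*} [NormedAddCommGroup E] [NormedSpace ℝ E]
    [CompleteSpace E] [SecondCountableTopology E] [MeasurableSpace E] [BorelSpace E]
    {ν : Measure E} [IsGaussian ν] (hν : ∀ L : StrongDual ℝ E, ∫ x, L x ∂ν = 0)
    (f g : StrongDual ℝ E) (u v : E)
    (hu : ∀ L, uncenteredCovarianceBilinDual ν L f = L u)
    (hv : ∀ L, uncenteredCovarianceBilinDual ν L g = L v)
    (hfg : g u = 0) (hnorm : f u + g v = 1) (hlt : f u < 1) (κ : ℝ) :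
    ν.map (fun x => x + (κ - g x - f x) • (u + v))
      = (ν.withDensity fun x => ENNReal.ofReal (1 / Real.sqrt (1 - f u) *
          Real.exp (-(f x - κ) ^ 2 / (2 * (1 - f u)) + κ ^ 2 / 2))).map
        (fun x => x + (κ - g x - f x) • (1 - f u)⁻¹ • v) := by
  set B := uncenteredCovarianceBilinDual ν with hB
  have hsymm : ∀ L L', B L L' = B L' L := fun L L' => by
    simp only [hB, uncenteredCovarianceBilinDual_apply IsGaussian.memLp_two_id, mul_comm]
  have hJ : 0 < 1 - f u := by linarith
  have hfv : f v = 0 := by rw [← hv, hsymm, hu, hfg]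
  set J := 1 - f u with hJdef
  have hfu : f u = 1 - J := by rw [hJdef]; ring
  have hgv : g v = J := by linarith
  have hfin : IsFiniteMeasure (ν.withDensity fun x => ENNReal.ofReal (1 / Real.sqrt J *
          Real.exp (-(f x - κ) ^ 2 / (2 * J) + κ ^ 2 / 2))) := by
    refine isFiniteMeasure_withDensity_ofReal ?_
    refine (Integrable.of_bound (by fun_prop)
      (1 / Real.sqrt J * Real.exp (κ ^ 2 / 2)) ?_).hasFiniteIntegral
    filter_upwards with x
    rw [Real.norm_of_nonneg (by positivity)]
    gcongr
    have : 0 ≤ (f x - κ) ^ 2 / (2 * J) := by positivity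
    rw [neg_div]
    linarith
  refine Measure.ext_of_charFunDual (funext fun L => ?_)
  set m := L v
  set l := L u
  set s := B L L
  -- characteristic functional of the left-hand side
  have hleft : charFunDual (ν.map (fun x => x + (κ - g x - f x) • (u + v))) L
      = Complex.exp (κ * (l + m) * Complex.I - (s - (l + m) ^ 2) / 2) := by
    rw [charFunDual_apply, integral_map (by fun_prop) (by fun_prop)]
    have h1 : ∀ x, Complex.exp (L (x + (κ - g x - f x) • (u + v)) * Complex.I)
        = Complex.exp (κ * (l + m) * Complex.I) *
          Complex.exp ((L - (l + m) • (g + f)) x * Complex.I) := by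
      intro x
      rw [← Complex.exp_add]
      congr 1
      simp [l, m]
      ring
    simp_rw [h1]
    rw [integral_const_mul, ← charFunDual_apply, charFunDual_eq_of_centered hν, ← Complex.exp_add,
      ← hB]
    have h2 : B (L - (l + m) • (g + f)) (L - (l + m) • (g + f)) = s - (l + m) ^ 2 := by
      simp only [map_sub, map_add, map_smul, sub_apply,
        add_apply, smul_apply, smul_eq_mul,
        hsymm f L, hsymm g L, hu, hv, hfg, hfv, hgv, hfu]
      simp only [l, m, s]
      ring
    rw [h2]
    congr 1
    push_cast
    ring
  -- Gaussian linearisation of the density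
  have hlin : ∀ x, ((1 / Real.sqrt J * Real.exp (-(f x - κ) ^ 2 / (2 * J) + κ ^ 2 / 2) : ℝ) : ℂ)
      = (1 / Real.sqrt (2 * Real.pi) : ℝ) *
        ∫ b : ℝ, Complex.exp (-(J / 2) * b ^ 2 + ((f x - κ) * Complex.I) * b + κ ^ 2 / 2) := by
    intro x
    rw [integral_cexp_neg_half_quadratic hJ]
    have h2 : (Real.sqrt (2 * Real.pi) : ℂ) ≠ 0 := by
      exact_mod_cast (by positivity : Real.sqrt (2 * Real.pi) ≠ 0)
    push_cast
    rw [mul_pow, Complex.I_sq]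
    field_simp
    congr 1
    ring_nf
  set m' := J⁻¹ * m
  have hm' : m = J * m' := by simp only [m']; field_simp
  have hinner : ∀ b : ℝ, ∫ x, Complex.exp (-(J / 2) * b ^ 2 + ((f x - κ) * Complex.I) * b
        + κ ^ 2 / 2) * Complex.exp (L (x + (κ - g x - f x) • J⁻¹ • v) * Complex.I) ∂ν
      = Complex.exp (-((1 : ℝ) / 2) * b ^ 2 + (-κ * Complex.I - l + m' * (1 - J)) * b
        + (κ ^ 2 / 2 + κ * m' * Complex.I - (s - m' ^ 2 * J + m' ^ 2 * (1 - J) - 2 * m' * l) / 2)) := by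
    intro b
    have h1 : ∀ x, Complex.exp (-(J / 2) * b ^ 2 + ((f x - κ) * Complex.I) * b
        + κ ^ 2 / 2) * Complex.exp (L (x + (κ - g x - f x) • J⁻¹ • v) * Complex.I)
        = Complex.exp (-(J / 2) * b ^ 2 - κ * Complex.I * b + κ ^ 2 / 2 + κ * m' * Complex.I) *
          Complex.exp ((L - m' • (g + f) + b • f) x * Complex.I) := by
      intro x
      rw [← Complex.exp_add, ← Complex.exp_add]
      congr 1
      simp [m', m]
      ring
    simp_rw [h1]
    rw [integral_const_mul, ← charFunDual_apply, charFunDual_eq_of_centered hν, ← Complex.exp_add,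
      ← hB]
    have h2 : B (L - m' • (g + f) + b • f) (L - m' • (g + f) + b • f)
        = s - m' ^ 2 * J + (b - m') ^ 2 * (1 - J) + 2 * (b - m') * l := by
      simp only [map_sub, map_add, map_smul, sub_apply,
        add_apply, smul_apply, smul_eq_mul,
        hsymm f L, hsymm g L, hu, hv, hfg, hfv, hgv, hfu]
      change s - _ + _ - _ + _ = _
      simp only [← show m = L v from rfl, ← show l = L u from rfl]
      rw [hm']
      ring
    rw [h2]
    congr 1
    push_cast
    ring
  have hright : charFunDual ((ν.withDensity fun x => ENNReal.ofReal (1 / Real.sqrt J *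
          Real.exp (-(f x - κ) ^ 2 / (2 * J) + κ ^ 2 / 2))).map
        (fun x => x + (κ - g x - f x) • J⁻¹ • v)) L
      = (1 / Real.sqrt (2 * Real.pi) : ℝ) * ∫ b : ℝ, ∫ x, Complex.exp (-(J / 2) * b ^ 2
        + ((f x - κ) * Complex.I) * b
        + κ ^ 2 / 2) * Complex.exp (L (x + (κ - g x - f x) • J⁻¹ • v) * Complex.I) ∂ν := by
    rw [charFunDual_apply, integral_map (by fun_prop) (by fun_prop),
      integral_withDensity_eq_integral_toReal_smul (by fun_prop)
        (ae_of_all _ fun _ => ENNReal.ofReal_lt_top)]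
    rw [← integral_integral_swap]
    · rw [← integral_const_mul]
      congr 1
      ext x
      rw [ENNReal.toReal_ofReal (by positivity), Complex.real_smul, hlin, integral_mul_const,
        mul_assoc]
    · have hdom : Integrable (fun p : E × ℝ => Real.exp (κ ^ 2 / 2) *
          Real.exp (-(J / 2) * p.2 ^ 2)) (ν.prod volume) :=
        (((integrable_exp_neg_mul_sq (by positivity : 0 < J / 2)).comp_snd ν).const_mul _)
      refine hdom.mono' (by fun_prop) ?_
      filter_upwards with p
      simp only [Function.uncurry]
      rw [norm_mul, Complex.norm_exp_ofReal_mul_I, mul_one, Complex.norm_exp, ← Real.exp_add]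
      apply le_of_eq
      congr 1
      have : (-(J / 2 : ℂ) * (p.2 : ℂ) ^ 2 + (f p.1 - κ) * Complex.I * p.2 + κ ^ 2 / 2)
        = ((-(J / 2) * p.2 ^ 2 + κ ^ 2 / 2 : ℝ) : ℂ)
          + (((f p.1 - κ) * p.2 : ℝ) : ℂ) * Complex.I := by
        push_cast; ring
      rw [this, Complex.add_re, Complex.ofReal_re, Complex.re_ofReal_mul, Complex.I_re]
      ring
  rw [hleft, hright]
  simp_rw [hinner]
  have h2 : (Real.sqrt (2 * Real.pi) : ℂ) ≠ 0 := by
    exact_mod_cast (by positivity : Real.sqrt (2 * Real.pi) ≠ 0)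
  have := integral_cexp_neg_half_quadratic one_pos (-κ * Complex.I - l + m' * (1 - J))
    (κ ^ 2 / 2 + κ * m' * Complex.I - (s - m' ^ 2 * J + m' ^ 2 * (1 - J) - 2 * m' * l) / 2)
  rw [this]
  simp only [Real.sqrt_one, Complex.ofReal_one, div_one, mul_one]
  rw [← mul_assoc, Complex.ofReal_div, Complex.ofReal_one, one_div_mul_cancel h2, one_mul]
  congr 1
  rw [hm']
  push_cast
  ring_nf
  simp only [Complex.I_sq]
  ring

theorem ContinuousMap.exists_continuousLinearMap_eq_integral {K : Type*} [TopologicalSpace K]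
    [CompactSpace K] [MeasurableSpace K] [BorelSpace K] (m : Measure K) [IsFiniteMeasure m] :
    ∃ L : StrongDual ℝ C(K, ℝ), ∀ x : C(K, ℝ), L x = ∫ t, x t ∂m := by
  have hint : ∀ x : C(K, ℝ), Integrable x m := fun x =>
    Integrable.of_bound x.continuous.measurable.aestronglyMeasurable ‖x‖
      (ae_of_all _ fun t => x.norm_coe_le_norm t)
  refine ⟨LinearMap.mkContinuous
    { toFun := fun x => ∫ t, x t ∂m
      map_add' := fun x y => integral_add (hint x) (hint y)
      map_smul' := fun c x => integral_const_mul c _ } (m.real univ) fun x => ?_, fun x => rfl⟩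
  rw [mul_comm]
  exact norm_integral_le_of_norm_le_const (ae_of_all _ fun t => x.norm_coe_le_norm t)

theorem exists_continuousLinearMap_eq_sint {K : Type*} [TopologicalSpace K] [CompactSpace K]
    [MeasurableSpace K] [BorelSpace K] (ν : SignedMeasure K) :
    ∃ L : StrongDual ℝ C(K, ℝ), ∀ x : C(K, ℝ), L x = sint ν x := by
  obtain ⟨L₁, h₁⟩ := ContinuousMap.exists_continuousLinearMap_eq_integral
    ν.toJordanDecomposition.posPart
  obtain ⟨L₂, h₂⟩ := ContinuousMap.exists_continuousLinearMap_eq_integral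
    ν.toJordanDecomposition.negPart
  exact ⟨L₁ - L₂, fun x => by simp [h₁, h₂, sint]⟩

section UnitInterval

variable {Ω : Type*} [MeasurableSpace Ω] [MeasurableSpace C(unitInterval, ℝ)]
  [BorelSpace C(unitInterval, ℝ)] {x : Ω → C(unitInterval, ℝ)}

theorem measurable_of_measurable_eval (hx : ∀ t, Measurable fun ω => x ω t) : Measurable x := by
  refine measurable_of_tendsto_metrizable (f := fun n ω => bernsteinApproximation n (x ω))
    (fun n => ?_) (tendsto_pi_nhds.2 fun ω => bernsteinApproximation_uniform (x ω))
  have h : (fun ω => bernsteinApproximation n (x ω))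
      = fun ω => ∑ k : Fin (n + 1), x ω (bernstein.z k) • bernstein n k := by
    ext ω t
    simp [bernsteinApproximation.apply, mul_comm]
  rw [h]
  exact Finset.measurable_sum _ fun k _ => (hx _).smul_const _

theorem exists_map_dual_eq_gaussianReal {P : Measure Ω} [IsProbabilityMeasure P]
    (hx : ∀ t, Measurable fun ω => x ω t)
    (hgauss : ∀ (n : ℕ) (t : Fin n → unitInterval) (a : Fin n → ℝ), ∃ v : NNReal,
      P.map (fun ω => ∑ i, a i * x ω (t i)) = gaussianReal 0 v)
    (L : StrongDual ℝ C(unitInterval, ℝ)) :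
    ∃ v : NNReal, (P.map x).map L = gaussianReal 0 v := by
  rw [Measure.map_map (by fun_prop) (measurable_of_measurable_eval hx)]
  refine map_eq_gaussianReal_zero_of_tendsto
    (f := fun n ω => ∑ k : Fin (n + 1), L (bernstein n k) * x ω (bernstein.z k))
    (fun n => Finset.measurable_sum _ fun k _ => (hx _).const_mul _) (fun ω => ?_)
    (fun n => hgauss _ _ _)
  refine ((L.continuous.tendsto _).comp (bernsteinApproximation_uniform (x ω))).congr fun n => ?_
  have h : bernsteinApproximation n (x ω)
      = ∑ k : Fin (n + 1), x ω (bernstein.z k) • bernstein n k := by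
    ext t
    simp [bernsteinApproximation.apply, mul_comm]
  simp [h, mul_comm]

end UnitInterval

theorem exists_uncenteredCovarianceBilinDual_eq {E : Type*} [NormedAddCommGroup E]
    [NormedSpace ℝ E] [CompleteSpace E] [SecondCountableTopology E] [MeasurableSpace E]
    [BorelSpace E] (ν : Measure E) [IsGaussian ν] (f : StrongDual ℝ E) :
    ∃ u : E, ∀ L, uncenteredCovarianceBilinDual ν L f = L u := by
  refine ⟨∫ x, f x • x ∂ν, fun L => ?_⟩
  have hint : Integrable (fun x => f x • x) ν :=
    memLp_one_iff_integrable.1 (MemLp.smul (p := 2) (q := 2) IsGaussian.memLp_two_id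
      (IsGaussian.memLp_dual ν f 2 (by simp)))
  rw [uncenteredCovarianceBilinDual_apply IsGaussian.memLp_two_id, ← L.integral_comp_comm hint]
  simp [mul_comm]

/-- Absolute continuity formula between two linear transformations of a continuous
centered Gaussian process `X` with covariance `q`.  With `Λ = Qλ`, `M = Qμ`,
`γ(ω) = ∫ ω dλ`, `a(ω) = ∫ ω dμ`, `I = ⟨Qλ,λ⟩ < 1`, assuming `⟨Qλ,μ⟩ = 0` and
`⟨Qλ,λ⟩ + ⟨Qμ,μ⟩ = 1`, setting `Y_t = X_t + (Λ_t + M_t)(κ - a(X) - γ(X))` and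
`Z_t = X_t + (1-I)⁻¹ M_t (κ - a(X) - γ(X))`, one has `E[Φ(Y)] = E[Φ(Z) ρ(Z)]` for
every bounded Borel `Φ`, where
`ρ(ω) = (1-I)^{-1/2} exp(-(γ(ω) - κ)²/(2(1-I)) + κ²/2)`. -/
theorem abs_continuity_gaussian_transforms
    {Ω : Type*} [MeasurableSpace Ω] (P : Measure Ω) [IsProbabilityMeasure P]
    (X : ℝ → Ω → ℝ) (q : ℝ → ℝ → ℝ)
    (hXmeas : ∀ t, Measurable (X t))
    (hXcont : ∀ ω, ContinuousOn (fun t => X t ω) (Icc 0 1))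
    (hXgauss : ∀ (n : ℕ) (t : Fin n → ℝ), (∀ i, t i ∈ Icc (0:ℝ) 1) →
      ∀ a : Fin n → ℝ, ∃ v : NNReal,
        Measure.map (fun ω => ∑ i, a i * X (t i) ω) P = gaussianReal 0 v)
    (hq : ∀ s ∈ Icc (0:ℝ) 1, ∀ t ∈ Icc (0:ℝ) 1, ∫ ω, X s ω * X t ω ∂P = q s t)
    (lam mu : MeasureTheory.SignedMeasure (Icc (0:ℝ) 1))
    (Λ M : ℝ → ℝ)
    (hΛ : ∀ t, Λ t = sint lam (fun s => q t s.1))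
    (hM : ∀ t, M t = sint mu (fun s => q t s.1))
    (γ a : Ω → ℝ)
    (hγ : ∀ ω, γ ω = sint lam (fun s => X s.1 ω))
    (ha : ∀ ω, a ω = sint mu (fun s => X s.1 ω))
    (I : ℝ) (hI : I = sint lam (fun s => Λ s.1))
    (horth : sint mu (fun s => Λ s.1) = 0)
    (hnorm : I + sint mu (fun s => M s.1) = 1)
    (hIlt : I < 1)
    (κ : ℝ) (Y Z : ℝ → Ω → ℝ)
    (hY : ∀ t ω, Y t ω = X t ω + (Λ t + M t) * (κ - a ω - γ ω))
    (hZ : ∀ t ω, Z t ω = X t ω + (1 - I)⁻¹ * M t * (κ - a ω - γ ω))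
    (Φ : (Icc (0:ℝ) 1 → ℝ) → ℝ) (hΦ : Measurable Φ) (hΦb : ∃ C, ∀ x, |Φ x| ≤ C) :
    ∫ ω, Φ (fun t => Y t.1 ω) ∂P
      = ∫ ω, Φ (fun t => Z t.1 ω) *
          ((1 / Real.sqrt (1 - I)) *
            Real.exp (-(sint lam (fun s => Z s.1 ω) - κ) ^ 2 / (2 * (1 - I))
              + κ ^ 2 / 2)) ∂P := by
  let _ : MeasurableSpace C(unitInterval, ℝ) := borel _
  have : BorelSpace C(unitInterval, ℝ) := ⟨rfl⟩
  set x : Ω → C(unitInterval, ℝ) := fun ω =>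
    ⟨fun t => X t.1 ω, continuousOn_iff_continuous_domRestrict.1 (hXcont ω)⟩
  have hxmeas : Measurable x := measurable_of_measurable_eval fun t => hXmeas t
  have hmap := exists_map_dual_eq_gaussianReal (P := P) (x := x) (fun t => hXmeas t)
    fun n t a => hXgauss n (fun i => (t i).1) (fun i => (t i).2) a
  set ν := P.map x
  have hgauss : IsGaussian ν := isGaussian_of_map_eq_gaussianReal fun L => ⟨0, hmap L⟩
  have hν : ∀ L : StrongDual ℝ C(unitInterval, ℝ), ∫ y, L y ∂ν = 0 := by
    intro L
    obtain ⟨v, hv⟩ := hmap L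
    rw [← integral_map (φ := L) (f := fun r => r) (by fun_prop) (by fun_prop), hv,
      integral_id_gaussianReal]
  obtain ⟨f, hf⟩ := exists_continuousLinearMap_eq_sint (K := unitInterval) lam
  obtain ⟨g, hg⟩ := exists_continuousLinearMap_eq_sint (K := unitInterval) mu
  obtain ⟨u, hu⟩ := exists_uncenteredCovarianceBilinDual_eq ν f
  obtain ⟨v, hv⟩ := exists_uncenteredCovarianceBilinDual_eq ν g
  let B := uncenteredCovarianceBilinDual ν
  have hB : ∀ L L', B L L' = ∫ y, L y * L' y ∂ν :=
    uncenteredCovarianceBilinDual_apply IsGaussian.memLp_two_id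
  have hsymm : ∀ L L', B L L' = B L' L := fun L L' => by simp only [hB, mul_comm]
  let ev : unitInterval → StrongDual ℝ C(unitInterval, ℝ) := fun t => ContinuousMap.evalCLM ℝ t
  have hcov : ∀ s t : unitInterval, B (ev s) (ev t) = q s t := by
    intro s t
    rw [hB, integral_map hxmeas.aemeasurable (by fun_prop), ← hq s s.2 t t.2]
    rfl
  have hrep : ∀ (ρ : SignedMeasure unitInterval) (h : StrongDual ℝ C(unitInterval, ℝ))
      (w : C(unitInterval, ℝ)), (∀ y : C(unitInterval, ℝ), h y = sint ρ y) →
      (∀ L, B L h = L w) → ∀ t : unitInterval, sint ρ (fun s => q t s.1) = w t := by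
    intro ρ h w hh hw t
    obtain ⟨k, hk⟩ := exists_uncenteredCovarianceBilinDual_eq ν (ev t)
    have hkq : ∀ s, k s = q t s := fun s => by
      rw [← hcov, hsymm]
      exact (hk (ev s)).symm
    calc sint ρ (fun s => q t s.1) = sint ρ k := by simp_rw [← hkq]
      _ = B h (ev t) := by rw [← hh, ← hk]
      _ = w t := by rw [hsymm, hw]; rfl
  have hΛu : ∀ t : unitInterval, Λ t = u t := fun t => by rw [hΛ, hrep lam f u hf hu]
  have hMv : ∀ t : unitInterval, M t = v t := fun t => by rw [hM, hrep mu g v hg hv]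
  have hfu : f u = I := by rw [hI, hf]; simp_rw [hΛu]
  have hgu : g u = 0 := by rw [← horth, hg]; simp_rw [hΛu]
  have hgv : f u + g v = 1 := by rw [← hnorm, hfu, hg]; simp_rw [hMv]
  have hfv : f v = 0 := ((hv f).symm.trans (hsymm f g)).trans ((hu g).trans hgu)
  have hγx : ∀ ω, γ ω = f (x ω) := fun ω => by rw [hγ, hf]; rfl
  have hax : ∀ ω, a ω = g (x ω) := fun ω => by rw [ha, hg]; rfl
  have hYx : ∀ ω, (fun t : unitInterval => Y t.1 ω)
      = ⇑(x ω + (κ - g (x ω) - f (x ω)) • (u + v)) := by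
    intro ω
    ext t
    rw [hY, hΛu, hMv, hγx, hax, mul_comm]
    rfl
  have hZx : ∀ ω, (fun t : unitInterval => Z t.1 ω)
      = ⇑(x ω + (κ - g (x ω) - f (x ω)) • (1 - I)⁻¹ • v) := by
    intro ω
    ext t
    rw [hZ, hMv, hγx, hax, mul_comm]
    rfl
  obtain ⟨Ψ, hΨ⟩ : ∃ Ψ : C(unitInterval, ℝ) → ℝ, ∀ y : C(unitInterval, ℝ), Ψ y = Φ y :=
    ⟨fun y => Φ y, fun _ => rfl⟩
  have hΨm : Measurable Ψ := by
    rw [funext hΨ]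
    exact hΦ.comp (measurable_pi_iff.2 fun t => (ev t).continuous.measurable)
  have hνint : ∀ F : C(unitInterval, ℝ) → ℝ, Measurable F → ∫ y, F y ∂ν = ∫ ω, F (x ω) ∂P :=
    fun F hF => integral_map hxmeas.aemeasurable hF.aestronglyMeasurable
  have key := map_add_smul_eq_map_withDensity hν f g u v hu hv hgu hgv (hfu ▸ hIlt) κ
  rw [hfu] at key
  have hint := congrArg (fun m : Measure C(unitInterval, ℝ) => ∫ y, Ψ y ∂m) key
  rw [integral_map (by fun_prop) hΨm.aestronglyMeasurable,
    integral_map (by fun_prop) hΨm.aestronglyMeasurable,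
    integral_withDensity_eq_integral_toReal_smul (by fun_prop)
      (ae_of_all _ fun _ => ENNReal.ofReal_lt_top),
    hνint _ (by fun_prop), hνint _ (by fun_prop)] at hint
  simp_rw [hYx, ← hΨ]
  rw [hint]
  refine integral_congr_ae (ae_of_all _ fun ω => ?_)
  have hsZ : sint lam (fun s => Z s.1 ω) = f (x ω) := by
    rw [hZx ω, ← hf]
    simp [hfv]
  simp only
  rw [hsZ, hZx ω, ← hΨ, ENNReal.toReal_ofReal (by positivity), smul_eq_mul, mul_comm]
end

section
/- Let B be a standard Brownian motion on [0,1] and β_t := B_t − t B_1 the Brownian bridge. For c ∈ ℝ set β^c_t := β_t + 6 t(1−t)(c − ∫₀¹ β_r dr). Then for every bounded Borel Φ : C([0,1]) → ℝ and every bounded Borel f : ℝ → ℝ, E[Φ(β) f(∫₀¹ β_r dr)] = ∫_ℝ E[Φ(β^c)] f(c) N(0,1/12)(dc); i.e. the family of laws of β^c, c ∈ ℝ, is a regular conditional distribution of β given its time average ∫₀¹ β. -/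
open MeasureTheory ProbabilityTheory Set

/-- `B` is a standard Brownian motion on `[0,1]`: a centered Gaussian process with
continuous paths and covariance `E[B_s B_t] = min s t`. -/
def IsBrownianMotion {Ω : Type*} [MeasurableSpace Ω] (P : Measure Ω)
    (B : ℝ → Ω → ℝ) : Prop :=
  (∀ t, Measurable (B t)) ∧
  (∀ ω, ContinuousOn (fun t => B t ω) (Icc 0 1)) ∧
  (∀ (n : ℕ) (t : Fin n → ℝ), (∀ i, t i ∈ Icc (0:ℝ) 1) → ∀ c : Fin n → ℝ,
    ∃ v : NNReal,
      Measure.map (fun ω => ∑ i, c i * B (t i) ω) P = gaussianReal 0 v) ∧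
  (∀ s ∈ Icc (0:ℝ) 1, ∀ t ∈ Icc (0:ℝ) 1, ∫ ω, B s ω * B t ω ∂P = min s t)

open Filter Topology
open scoped NNReal

theorem tendsto_riemannSum {f : ℝ → ℝ} (hf : Continuous f) :
    Tendsto (fun n : ℕ => ∑ k ∈ Finset.range (n + 1), (1 / (n + 1 : ℝ)) * f (k / (n + 1 : ℝ)))
      atTop (𝓝 (∫ x in (0:ℝ)..1, f x)) := by
  have huc := (isCompact_Icc (a := (0:ℝ)) (b := 1)).uniformContinuousOn_of_continuous
    hf.continuousOn
  rw [Metric.uniformContinuousOn_iff_le] at huc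
  rw [Metric.tendsto_nhds]
  intro ε hε
  obtain ⟨δ, hδ, h⟩ := huc (ε / 2) (by positivity)
  filter_upwards [tendsto_one_div_add_atTop_nhds_zero_nat.eventually (gt_mem_nhds hδ)] with n hn
  have hn0 : (0 : ℝ) < n + 1 := by positivity
  have hsum : ∑ k ∈ Finset.range (n + 1), ∫ x in (k / (n + 1 : ℝ))..((k + 1 : ℕ) / (n + 1 : ℝ)), f x
      = ∫ x in (0:ℝ)..1, f x := by
    rw [intervalIntegral.sum_integral_adjacent_intervals
      (a := fun k : ℕ => (k / (n + 1 : ℝ))) (fun k _ => hf.intervalIntegrable _ _)]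
    congr 1 <;> push_cast
    · simp
    · field_simp
  have hterm : ∀ k ∈ Finset.range (n + 1),
      |(1 / (n + 1 : ℝ)) * f (k / (n + 1 : ℝ))
        - ∫ x in (k / (n + 1 : ℝ))..((k + 1 : ℕ) / (n + 1 : ℝ)), f x|
      ≤ ε / 2 * (1 / (n + 1 : ℝ)) := by
    intro k hk
    have hk' : (k : ℝ) + 1 ≤ n + 1 := by exact_mod_cast Finset.mem_range.1 hk
    have hlen : ((k + 1 : ℕ) / (n + 1 : ℝ)) - k / (n + 1 : ℝ) = 1 / (n + 1 : ℝ) := by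
      push_cast; ring
    have h1 : ((k + 1 : ℕ) / (n + 1 : ℝ)) ≤ 1 := by
      rw [div_le_one hn0]; exact_mod_cast hk'
    have h0 : 0 ≤ k / (n + 1 : ℝ) := by positivity
    have hpos : 0 < 1 / (n + 1 : ℝ) := by positivity
    have hc : (1 / (n + 1 : ℝ)) * f (k / (n + 1 : ℝ))
        = ∫ x in (k / (n + 1 : ℝ))..((k + 1 : ℕ) / (n + 1 : ℝ)), f (k / (n + 1 : ℝ)) := by
      rw [intervalIntegral.integral_const, hlen, smul_eq_mul]
    rw [hc, ← intervalIntegral.integral_sub (by simp) (hf.intervalIntegrable _ _)]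
    have := intervalIntegral.norm_integral_le_of_norm_le_const
      (a := k / (n + 1 : ℝ)) (b := (k + 1 : ℕ) / (n + 1 : ℝ)) (C := ε / 2)
      (f := fun x => f (k / (n + 1 : ℝ)) - f x) (fun x hx => by
        rw [uIoc_of_le (by linarith)] at hx
        rw [← dist_eq_norm]
        refine h _ ⟨h0, by linarith⟩ _ ⟨by linarith [hx.1], by linarith [hx.2]⟩ ?_
        rw [Real.dist_eq, abs_le]
        constructor <;> linarith [hx.1, hx.2])
    rwa [hlen, abs_of_pos hpos, Real.norm_eq_abs] at this
  rw [Real.dist_eq, ← hsum, ← Finset.sum_sub_distrib]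
  calc _ ≤ ∑ k ∈ Finset.range (n + 1), ε / 2 * (1 / (n + 1 : ℝ)) :=
        (Finset.abs_sum_le_sum_abs _ _).trans (Finset.sum_le_sum hterm)
    _ = ε / 2 := by
        rw [Finset.sum_const, Finset.card_range, nsmul_eq_mul]; push_cast; field_simp
    _ < ε := by linarith

theorem tendsto_charFun_map {Ω : Type*} [MeasurableSpace Ω] {P : Measure Ω}
    [IsProbabilityMeasure P] {Z : ℕ → Ω → ℝ} {Y : Ω → ℝ} (hZ : ∀ n, AEMeasurable (Z n) P)
    (hY : AEMeasurable Y P)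
    (hlim : ∀ ω, Tendsto (fun n => Z n ω) atTop (𝓝 (Y ω))) (t : ℝ) :
    Tendsto (fun n => charFun (P.map (Z n)) t) atTop (𝓝 (charFun (P.map Y) t)) := by
  simp only [charFun_apply_real]
  rw [integral_map hY (by fun_prop)]
  simp_rw [fun n => integral_map (hZ n) (f := fun x : ℝ => Complex.exp (t * x * Complex.I))
    (by fun_prop)]
  refine tendsto_integral_of_dominated_convergence (fun _ => 1) (fun n => ?_) (by simp)
    (fun n => .of_forall fun ω => ?_) (.of_forall fun ω => ?_)
  · have := hZ n
    exact AEMeasurable.aestronglyMeasurable (by fun_prop)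
  · rw [← Complex.ofReal_mul, Complex.norm_exp_ofReal_mul_I]
  · have hc : Continuous fun x : ℝ => Complex.exp (t * x * Complex.I) := by fun_prop
    exact (hc.tendsto _).comp (hlim ω)

/-- A pointwise limit of centered Gaussian variables is centered Gaussian. -/
theorem exists_map_eq_gaussianReal_of_tendsto {Ω : Type*} [MeasurableSpace Ω] {P : Measure Ω}
    [IsProbabilityMeasure P] {Z : ℕ → Ω → ℝ} {Y : Ω → ℝ} {v : ℕ → ℝ≥0}
    (hZ : ∀ n, AEMeasurable (Z n) P) (hY : AEMeasurable Y P)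
    (hlaw : ∀ n, P.map (Z n) = gaussianReal 0 (v n))
    (hlim : ∀ ω, Tendsto (fun n => Z n ω) atTop (𝓝 (Y ω))) :
    ∃ w : ℝ≥0, P.map Y = gaussianReal 0 w := by
  have : IsProbabilityMeasure (P.map Y) := Measure.isProbabilityMeasure_map hY
  have hφ := tendsto_charFun_map hZ hY hlim
  have hval (n : ℕ) (t : ℝ) :
      charFun (P.map (Z n)) t = (Real.exp (-(v n * t ^ 2 / 2)) : ℝ) := by
    rw [hlaw, charFun_gaussianReal]; push_cast; congr 1; simp
  simp_rw [hval] at hφ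
  obtain ⟨s, hs, hs0⟩ : ∃ s : ℝ, charFun (P.map Y) s ≠ 0 ∧ s ≠ 0 := by
    have hc : ContinuousAt (charFun (P.map Y)) 0 := (continuous_charFun).continuousAt
    have hev := hc.eventually_ne (y := 0) (by simp)
    have h2 := (hev.filter_mono nhdsWithin_le_nhds).and
      (self_mem_nhdsWithin : ({0}ᶜ : Set ℝ) ∈ 𝓝[≠] 0)
    obtain ⟨s, h, h'⟩ := h2.exists
    exact ⟨s, h, h'⟩
  have hv : Tendsto (fun n => (v n : ℝ)) atTop
      (𝓝 (-2 * Real.log ‖charFun (P.map Y) s‖ / s ^ 2)) := by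
    have h1 := ((hφ s).norm.log (norm_ne_zero_iff.2 hs)).const_mul (-2) |>.div_const (s ^ 2)
    refine h1.congr fun n => ?_
    rw [Complex.norm_real, Real.norm_of_nonneg (Real.exp_pos _).le, Real.log_exp]
    field_simp
  generalize -2 * Real.log ‖charFun (P.map Y) s‖ / s ^ 2 = w at hv
  have hw : 0 ≤ w := ge_of_tendsto' hv fun n => (v n).2
  lift w to ℝ≥0 using hw
  refine ⟨w, Measure.ext_of_charFun (funext fun t => ?_)⟩
  refine tendsto_nhds_unique (hφ t) ?_
  have hexp : charFun (gaussianReal 0 w) t = (Real.exp (-(w * t ^ 2 / 2)) : ℝ) := by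
    rw [charFun_gaussianReal]; push_cast; congr 1; simp
  rw [hexp]
  have hc : Continuous fun x : ℝ => ((Real.exp (-(x * t ^ 2 / 2)) : ℝ) : ℂ) := by fun_prop
  exact (hc.tendsto _).comp hv

/-- A pointwise limit of centered Gaussian processes is Gaussian. -/
theorem isGaussianProcess_of_tendsto {Ω T : Type*} [MeasurableSpace Ω] {P : Measure Ω}
    [IsProbabilityMeasure P] {X : ℕ → T → Ω → ℝ} {Y : T → Ω → ℝ}
    (hX : ∀ n, IsGaussianProcess (X n) P) (hX0 : ∀ n t, ∫ ω, X n t ω ∂P = 0)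
    (hY : ∀ t, Measurable (Y t))
    (hlim : ∀ t ω, Tendsto (fun n => X n t ω) atTop (𝓝 (Y t ω))) :
    IsGaussianProcess Y P where
  hasGaussianLaw I := by
    have hYm : Measurable fun ω => I.restrict (Y · ω) := measurable_pi_iff.2 fun i => hY i
    refine ⟨isGaussian_of_map_eq_gaussianReal fun L => ?_⟩
    rw [Measure.map_map (by fun_prop) hYm]
    have hg (n : ℕ) := ((hX n).hasGaussianLaw I).map_fun L
    obtain ⟨w, hw⟩ := exists_map_eq_gaussianReal_of_tendsto
      (Z := fun n ω => L (I.restrict (X n · ω)))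
      (Y := fun ω => L (I.restrict (Y · ω))) (v := fun n => _)
      (fun n => (hg n).aemeasurable) (L.measurable.comp hYm).aemeasurable (fun n => by
        have h0 : ∫ ω, L (I.restrict (X n · ω)) ∂P = 0 := by
          rw [L.integral_comp_comm ((hX n).hasGaussianLaw I).integrable]
          have : ∫ ω, I.restrict (X n · ω) ∂P = 0 := by
            ext i
            refine (eval_integral (f := fun ω => I.restrict (X n · ω)) fun i : I =>
              ((hX n).hasGaussianLaw_eval i).integrable) i |>.trans ?_
            exact hX0 n i
          rw [this, map_zero]
        rw [(hg n).map_eq_gaussianReal, h0])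
      (fun ω => (L.continuous.tendsto _).comp (tendsto_pi_nhds.2 fun i => hlim i ω))
    exact ⟨0, w, hw⟩

theorem IsBrownianMotion.integral_eq_zero {Ω : Type*} [MeasurableSpace Ω] {P : Measure Ω}
    {B : ℝ → Ω → ℝ} (hB : IsBrownianMotion P B) {t : ℝ} (ht : t ∈ Icc (0:ℝ) 1) :
    ∫ ω, B t ω ∂P = 0 := by
  obtain ⟨v, hv⟩ := hB.2.2.1 1 (fun _ => t) (fun _ => ht) (fun _ => 1)
  simp only [Finset.univ_unique, one_mul, Finset.sum_const, Finset.card_singleton, one_smul] at hv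
  have := integral_map (μ := P) (hB.1 t).aemeasurable (f := fun x : ℝ => x) (by fun_prop)
  rw [← this, hv, integral_id_gaussianReal]

theorem IsBrownianMotion.isGaussianProcess {Ω : Type*} [MeasurableSpace Ω] {P : Measure Ω}
    {B : ℝ → Ω → ℝ} (hB : IsBrownianMotion P B) :
    IsGaussianProcess (fun t : Icc (0:ℝ) 1 => B t) P where
  hasGaussianLaw I := by
    classical
    have hm : Measurable fun ω => I.restrict (fun t : Icc (0:ℝ) 1 => B t ω) :=
      measurable_pi_iff.2 fun i => hB.1 _
    refine ⟨isGaussian_of_map_eq_gaussianReal fun L => ?_⟩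
    obtain ⟨v, hv⟩ := hB.2.2.1 _ (fun i => ((Fintype.equivFin I).symm i : Icc (0:ℝ) 1).1)
      (fun i => Subtype.property _) (fun i => L (Pi.single ((Fintype.equivFin I).symm i) 1))
    refine ⟨0, v, ?_⟩
    rw [Measure.map_map (by fun_prop) hm, ← hv]
    refine congrArg (fun F => P.map F) (funext fun ω => ?_)
    rw [(Fintype.equivFin I).symm.sum_comp (fun i : I => L (Pi.single i 1) * B i.1.1 ω)]
    simp only [Function.comp_apply]
    conv_lhs => rw [← ContinuousLinearMap.coe_coe, LinearMap.pi_apply_eq_sum_univ]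
    refine Finset.sum_congr rfl fun i _ => ?_
    have hi : (fun j => if i = j then (1 : ℝ) else 0) = Pi.single i 1 := by
      ext j
      simp [Pi.single_apply, eq_comm]
    rw [smul_eq_mul, mul_comm, hi]
    rfl

/-- A process on `[0,1]` augmented with its time average, at the index `none`. -/
noncomputable def withTimeAverage {Ω : Type*} (B : ℝ → Ω → ℝ) (o : Option (Icc (0:ℝ) 1)) (ω : Ω) :
    ℝ :=
  o.elim (∫ r in (0:ℝ)..1, B r ω) fun t => B t ω

theorem integral_eq_integral_projIcc (f : ℝ → ℝ) :
    ∫ r in (0:ℝ)..1, f r = ∫ r in (0:ℝ)..1, f (projIcc (0:ℝ) 1 zero_le_one r) := by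
  refine intervalIntegral.integral_congr fun r hr => ?_
  rw [uIcc_of_le zero_le_one] at hr
  simp [projIcc_of_mem _ hr]

theorem continuous_comp_projIcc {f : ℝ → ℝ} (hf : ContinuousOn f (Icc 0 1)) :
    Continuous fun r => f (projIcc (0:ℝ) 1 zero_le_one r) :=
  hf.comp_continuous (by fun_prop) fun r => Subtype.property _

theorem IsBrownianMotion.measurable_uncurry_projIcc {Ω : Type*} [MeasurableSpace Ω]
    {P : Measure Ω} {B : ℝ → Ω → ℝ} (hB : IsBrownianMotion P B) :
    Measurable (Function.uncurry fun r => B (projIcc (0:ℝ) 1 zero_le_one r)) :=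
  measurable_uncurry_of_continuous_of_measurable
    (fun ω => continuous_comp_projIcc (hB.2.1 ω)) fun _ => hB.1 _

theorem IsBrownianMotion.measurable_withTimeAverage {Ω : Type*} [MeasurableSpace Ω]
    {P : Measure Ω} {B : ℝ → Ω → ℝ} (hB : IsBrownianMotion P B) (o : Option (Icc (0:ℝ) 1)) :
    Measurable (withTimeAverage B o) := by
  cases o with
  | some t => exact hB.1 t
  | none =>
    have h : withTimeAverage B none
        = fun ω => ∫ r in Ioc (0:ℝ) 1, B (projIcc (0:ℝ) 1 zero_le_one r) ω := by
      ext ω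
      rw [← intervalIntegral.integral_of_le zero_le_one]
      exact integral_eq_integral_projIcc fun r => B r ω
    rw [h]
    exact (StronglyMeasurable.integral_prod_left'
      hB.measurable_uncurry_projIcc.stronglyMeasurable).measurable

theorem IsBrownianMotion.isGaussianProcess_withTimeAverage {Ω : Type*} [MeasurableSpace Ω]
    {P : Measure Ω} [IsProbabilityMeasure P] {B : ℝ → Ω → ℝ} (hB : IsBrownianMotion P B) :
    IsGaussianProcess (withTimeAverage B) P := by
  classical
  let p (n k : ℕ) : Icc (0:ℝ) 1 := projIcc (0:ℝ) 1 zero_le_one (k / (n + 1 : ℝ))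
  refine isGaussianProcess_of_tendsto
    (X := fun n o ω => o.elim (∑ k ∈ Finset.range (n + 1), (1 / (n + 1 : ℝ)) * B (p n k) ω)
      fun t => B t ω) (fun n => ?_) (fun n o => ?_) hB.measurable_withTimeAverage fun o ω => ?_
  · refine hB.isGaussianProcess.of_isGaussianProcess fun o => ?_
    cases o with
    | some t => exact ⟨{t}, .proj ⟨t, by simp⟩, fun ω => rfl⟩
    | none =>
      refine ⟨(Finset.range (n + 1)).image (p n), ∑ k ∈ (Finset.range (n + 1)).attach,
        (1 / (n + 1 : ℝ)) • .proj ⟨p n k, Finset.mem_image_of_mem _ k.2⟩, fun ω => ?_⟩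
      simp [Finset.sum_attach _ fun k => (n + 1 : ℝ)⁻¹ * B (p n k) ω]
  · cases o with
    | some t => exact hB.integral_eq_zero t.2
    | none =>
      simp only [Option.elim_none]
      rw [integral_finsetSum _ fun k _ =>
        (hB.isGaussianProcess.hasGaussianLaw_eval (p n k)).integrable.const_mul _]
      simp [integral_const_mul, hB.integral_eq_zero (p n _).2]
  · cases o with
    | some t => exact tendsto_const_nhds
    | none =>
      simp only [Option.elim_none, withTimeAverage]
      rw [integral_eq_integral_projIcc]
      exact tendsto_riemannSum (continuous_comp_projIcc (hB.2.1 ω))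

theorem IsBrownianMotion.memLp_two {Ω : Type*} [MeasurableSpace Ω]
    {P : Measure Ω} {B : ℝ → Ω → ℝ} (hB : IsBrownianMotion P B) {t : ℝ} (ht : t ∈ Icc (0:ℝ) 1) :
    MemLp (B t) 2 P :=
  (hB.isGaussianProcess.hasGaussianLaw_eval ⟨t, ht⟩).memLp_two

/-- Fubini for the product of the time average with a square integrable variable. -/
theorem IsBrownianMotion.integral_timeAverage_mul {Ω : Type*} [MeasurableSpace Ω]
    {P : Measure Ω} [IsProbabilityMeasure P] {B : ℝ → Ω → ℝ} (hB : IsBrownianMotion P B)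
    {Y : Ω → ℝ} (hY : Measurable Y) (hY2 : MemLp Y 2 P) :
    ∫ ω, (∫ r in (0:ℝ)..1, B r ω) * Y ω ∂P = ∫ r in (0:ℝ)..1, ∫ ω, B r ω * Y ω ∂P := by
  rw [integral_eq_integral_projIcc fun r => ∫ ω, B r ω * Y ω ∂P]
  simp_rw [fun ω => integral_eq_integral_projIcc fun r => B r ω,
    ← intervalIntegral.integral_mul_const]
  simp_rw [intervalIntegral.integral_of_le zero_le_one]
  have hm : Measurable fun z : ℝ × Ω => B (projIcc (0:ℝ) 1 zero_le_one z.1) z.2 * Y z.2 :=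
    hB.measurable_uncurry_projIcc.mul (hY.comp measurable_snd)
  have hp (r : ℝ) := (projIcc (0:ℝ) 1 zero_le_one r).2
  have hint : Integrable (fun z : ℝ × Ω => B (projIcc (0:ℝ) 1 zero_le_one z.1) z.2 * Y z.2)
      ((volume.restrict (Ioc (0:ℝ) 1)).prod P) := by
    rw [integrable_prod_iff hm.aestronglyMeasurable]
    refine ⟨.of_forall fun r => (hB.memLp_two (hp r)).integrable_mul hY2, ?_⟩
    refine Integrable.mono' (g := fun _ => (1 + ∫ ω, Y ω ^ 2 ∂P) / 2) (integrable_const _)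
      (hm.norm.stronglyMeasurable.integral_prod_right').aestronglyMeasurable
      (.of_forall fun r => ?_)
    rw [Real.norm_of_nonneg (by positivity)]
    have hB2 : ∫ ω, B (projIcc (0:ℝ) 1 zero_le_one r) ω ^ 2 ∂P ≤ 1 := by
      simp_rw [pow_two]
      rw [hB.2.2.2 _ (hp r) _ (hp r), min_self]
      exact (hp r).2
    calc _ ≤ ∫ ω, (B (projIcc (0:ℝ) 1 zero_le_one r) ω ^ 2 + Y ω ^ 2) / 2 ∂P := by
          refine integral_mono ((hB.memLp_two (hp r)).integrable_mul hY2).norm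
            (((hB.memLp_two (hp r)).integrable_sq.add hY2.integrable_sq).div_const 2) fun ω => ?_
          simp only [Real.norm_eq_abs, abs_mul]
          nlinarith [sq_nonneg (|B (projIcc (0:ℝ) 1 zero_le_one r) ω| - |Y ω|),
            sq_abs (B (projIcc (0:ℝ) 1 zero_le_one r) ω), sq_abs (Y ω)]
      _ ≤ _ := by
          rw [integral_div, integral_add (hB.memLp_two (hp r)).integrable_sq hY2.integrable_sq]
          linarith
  exact (integral_integral_swap hint).symm

theorem integral_min {t : ℝ} (ht : t ∈ Icc (0:ℝ) 1) :
    ∫ r in (0:ℝ)..1, min r t = t - t ^ 2 / 2 := by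
  have hc : Continuous fun r : ℝ => min r t := by fun_prop
  rw [← intervalIntegral.integral_add_adjacent_intervals (b := t)
    (hc.intervalIntegrable _ _) (hc.intervalIntegrable _ _)]
  have h1 : ∫ r in (0:ℝ)..t, min r t = ∫ r in (0:ℝ)..t, r :=
    intervalIntegral.integral_congr fun r hr => by
      rw [uIcc_of_le ht.1] at hr; exact min_eq_left hr.2
  have h2 : ∫ r in t..1, min r t = ∫ r in t..1, t :=
    intervalIntegral.integral_congr fun r hr => by
      rw [uIcc_of_le ht.2] at hr; exact min_eq_right hr.1
  rw [h1, h2, integral_id, intervalIntegral.integral_const, smul_eq_mul]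
  ring

theorem IsBrownianMotion.integral_timeAverage_mul_apply {Ω : Type*} [MeasurableSpace Ω]
    {P : Measure Ω} [IsProbabilityMeasure P] {B : ℝ → Ω → ℝ} (hB : IsBrownianMotion P B)
    {t : ℝ} (ht : t ∈ Icc (0:ℝ) 1) :
    ∫ ω, (∫ r in (0:ℝ)..1, B r ω) * B t ω ∂P = t - t ^ 2 / 2 := by
  rw [hB.integral_timeAverage_mul (hB.1 t) (hB.memLp_two ht), ← integral_min ht]
  refine intervalIntegral.integral_congr fun r hr => ?_
  rw [uIcc_of_le zero_le_one] at hr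
  exact hB.2.2.2 r hr t ht

theorem IsBrownianMotion.memLp_timeAverage {Ω : Type*} [MeasurableSpace Ω]
    {P : Measure Ω} [IsProbabilityMeasure P] {B : ℝ → Ω → ℝ} (hB : IsBrownianMotion P B) :
    MemLp (fun ω => ∫ r in (0:ℝ)..1, B r ω) 2 P :=
  (hB.isGaussianProcess_withTimeAverage.hasGaussianLaw_eval none).memLp_two

theorem IsBrownianMotion.integral_timeAverage_mul_self {Ω : Type*} [MeasurableSpace Ω]
    {P : Measure Ω} [IsProbabilityMeasure P] {B : ℝ → Ω → ℝ} (hB : IsBrownianMotion P B) :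
    ∫ ω, (∫ r in (0:ℝ)..1, B r ω) * (∫ r in (0:ℝ)..1, B r ω) ∂P = 1 / 3 := by
  rw [hB.integral_timeAverage_mul (Y := fun ω => ∫ r in (0:ℝ)..1, B r ω)
    (hB.measurable_withTimeAverage none) hB.memLp_timeAverage]
  have : ∫ r in (0:ℝ)..1, ∫ ω, B r ω * (∫ r in (0:ℝ)..1, B r ω) ∂P
      = ∫ r in (0:ℝ)..1, (r - r ^ 2 / 2) := by
    refine intervalIntegral.integral_congr fun r hr => ?_
    rw [uIcc_of_le zero_le_one] at hr
    simp_rw [← hB.integral_timeAverage_mul_apply hr, mul_comm]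
  rw [this, intervalIntegral.integral_sub (by simp)
    (Continuous.intervalIntegrable (by fun_prop) _ _)]
  simp only [integral_id, intervalIntegral.integral_div, integral_pow]
  norm_num

theorem IsBrownianMotion.integral_timeAverage {Ω : Type*} [MeasurableSpace Ω]
    {P : Measure Ω} [IsProbabilityMeasure P] {B : ℝ → Ω → ℝ} (hB : IsBrownianMotion P B) :
    ∫ ω, (∫ r in (0:ℝ)..1, B r ω) ∂P = 0 := by
  have h := hB.integral_timeAverage_mul (Y := fun _ => 1) measurable_const (memLp_const 1)
  simp only [mul_one] at h
  rw [h, intervalIntegral.integral_congr (g := fun _ => 0)]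
  · simp
  · intro r hr
    rw [uIcc_of_le zero_le_one] at hr
    exact hB.integral_eq_zero hr

theorem IsBrownianMotion.intervalIntegral_bridge {Ω : Type*} [MeasurableSpace Ω]
    {P : Measure Ω} {B : ℝ → Ω → ℝ} (hB : IsBrownianMotion P B) (ω : Ω) :
    ∫ r in (0:ℝ)..1, (B r ω - r * B 1 ω) = (∫ r in (0:ℝ)..1, B r ω) - 1 / 2 * B 1 ω := by
  have hi : IntervalIntegrable (fun r => B r ω) volume 0 1 :=
    ContinuousOn.intervalIntegrable (by rw [uIcc_of_le zero_le_one]; exact hB.2.1 ω)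
  rw [intervalIntegral.integral_sub hi (Continuous.intervalIntegrable (by fun_prop) _ _),
    intervalIntegral.integral_mul_const,
    integral_id]
  norm_num

theorem IsBrownianMotion.covariance_eq_min {Ω : Type*} [MeasurableSpace Ω]
    {P : Measure Ω} [IsProbabilityMeasure P] {B : ℝ → Ω → ℝ} (hB : IsBrownianMotion P B)
    {s t : ℝ} (hs : s ∈ Icc (0:ℝ) 1) (ht : t ∈ Icc (0:ℝ) 1) : cov[B s, B t; P] = min s t := by
  rw [covariance_eq_sub (hB.memLp_two hs) (hB.memLp_two ht), hB.integral_eq_zero hs, zero_mul,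
    sub_zero]
  exact hB.2.2.2 s hs t ht

theorem IsBrownianMotion.covariance_timeAverage_apply {Ω : Type*} [MeasurableSpace Ω]
    {P : Measure Ω} [IsProbabilityMeasure P] {B : ℝ → Ω → ℝ} (hB : IsBrownianMotion P B)
    {t : ℝ} (ht : t ∈ Icc (0:ℝ) 1) :
    cov[fun ω => ∫ r in (0:ℝ)..1, B r ω, B t; P] = t - t ^ 2 / 2 := by
  rw [covariance_eq_sub hB.memLp_timeAverage (hB.memLp_two ht), hB.integral_eq_zero ht, mul_zero,
    sub_zero]
  exact hB.integral_timeAverage_mul_apply ht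

theorem IsBrownianMotion.covariance_timeAverage_self {Ω : Type*} [MeasurableSpace Ω]
    {P : Measure Ω} [IsProbabilityMeasure P] {B : ℝ → Ω → ℝ} (hB : IsBrownianMotion P B) :
    cov[fun ω => ∫ r in (0:ℝ)..1, B r ω, fun ω => ∫ r in (0:ℝ)..1, B r ω; P] = 1 / 3 := by
  rw [covariance_eq_sub hB.memLp_timeAverage hB.memLp_timeAverage, hB.integral_timeAverage,
    mul_zero, sub_zero]
  exact hB.integral_timeAverage_mul_self

/-- The time average of the Brownian bridge `B t - t * B 1`. -/
noncomputable def bridgeAverage {Ω : Type*} (B : ℝ → Ω → ℝ) (ω : Ω) : ℝ :=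
  (∫ r in (0:ℝ)..1, B r ω) - 1 / 2 * B 1 ω

/-- The component of the Brownian bridge that is orthogonal to its time average. -/
noncomputable def bridgeResidual {Ω : Type*} (B : ℝ → Ω → ℝ) (t : ℝ) (ω : Ω) : ℝ :=
  B t ω - t * B 1 ω - 6 * t * (1 - t) * bridgeAverage B ω

theorem IsBrownianMotion.memLp_bridgeAverage {Ω : Type*} [MeasurableSpace Ω]
    {P : Measure Ω} [IsProbabilityMeasure P] {B : ℝ → Ω → ℝ} (hB : IsBrownianMotion P B) :
    MemLp (bridgeAverage B) 2 P :=
  hB.memLp_timeAverage.sub ((hB.memLp_two (by simp)).const_mul _)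

theorem IsBrownianMotion.measurable_bridgeAverage {Ω : Type*} [MeasurableSpace Ω]
    {P : Measure Ω} {B : ℝ → Ω → ℝ} (hB : IsBrownianMotion P B) :
    Measurable (bridgeAverage B) :=
  (hB.measurable_withTimeAverage none).sub ((hB.1 1).const_mul _)

theorem IsBrownianMotion.measurable_bridgeResidual {Ω : Type*} [MeasurableSpace Ω]
    {P : Measure Ω} {B : ℝ → Ω → ℝ} (hB : IsBrownianMotion P B) (t : ℝ) :
    Measurable (bridgeResidual B t) :=
  ((hB.1 t).sub ((hB.1 1).const_mul _)).sub (hB.measurable_bridgeAverage.const_mul _)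

theorem IsBrownianMotion.covariance_apply_bridgeAverage {Ω : Type*} [MeasurableSpace Ω]
    {P : Measure Ω} [IsProbabilityMeasure P] {B : ℝ → Ω → ℝ} (hB : IsBrownianMotion P B)
    {t : ℝ} (ht : t ∈ Icc (0:ℝ) 1) :
    cov[B t, bridgeAverage B; P] = t * (1 - t) / 2 := by
  have h1 : (1:ℝ) ∈ Icc (0:ℝ) 1 := by simp
  unfold bridgeAverage
  rw [covariance_fun_sub_right (hB.memLp_two ht) hB.memLp_timeAverage
      ((hB.memLp_two h1).const_mul _), covariance_const_mul_right, covariance_comm,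
    hB.covariance_timeAverage_apply ht, hB.covariance_eq_min ht h1, min_eq_left ht.2]
  ring

theorem IsBrownianMotion.covariance_bridgeAverage_self {Ω : Type*} [MeasurableSpace Ω]
    {P : Measure Ω} [IsProbabilityMeasure P] {B : ℝ → Ω → ℝ} (hB : IsBrownianMotion P B) :
    cov[bridgeAverage B, bridgeAverage B; P] = 1 / 12 := by
  have h1 : (1:ℝ) ∈ Icc (0:ℝ) 1 := by simp
  have hA := hB.memLp_timeAverage
  have hB1 := (hB.memLp_two h1).const_mul (1 / 2)
  unfold bridgeAverage
  rw [covariance_fun_sub_fun_sub hA hB1 hA hB1]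
  simp only [covariance_const_mul_left, covariance_const_mul_right]
  rw [covariance_comm (B 1) (fun ω => ∫ r in (0:ℝ)..1, B r ω), hB.covariance_timeAverage_self,
    hB.covariance_timeAverage_apply h1, hB.covariance_eq_min h1 h1]
  norm_num

theorem IsBrownianMotion.covariance_bridgeResidual_bridgeAverage {Ω : Type*} [MeasurableSpace Ω]
    {P : Measure Ω} [IsProbabilityMeasure P] {B : ℝ → Ω → ℝ} (hB : IsBrownianMotion P B)
    {t : ℝ} (ht : t ∈ Icc (0:ℝ) 1) :
    cov[bridgeResidual B t, bridgeAverage B; P] = 0 := by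
  have h1 : (1:ℝ) ∈ Icc (0:ℝ) 1 := by simp
  have hX := hB.memLp_bridgeAverage
  have hB1 := (hB.memLp_two h1).const_mul t
  change cov[fun ω => B t ω - t * B 1 ω - 6 * t * (1 - t) * bridgeAverage B ω, _; P] = 0
  rw [covariance_fun_sub_left (X := fun ω => B t ω - t * B 1 ω) ((hB.memLp_two ht).sub hB1)
      (hX.const_mul _) hX,
    covariance_fun_sub_left (hB.memLp_two ht) hB1 hX, covariance_const_mul_left,
    covariance_const_mul_left, hB.covariance_apply_bridgeAverage ht,
    hB.covariance_apply_bridgeAverage h1, hB.covariance_bridgeAverage_self]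
  ring

theorem IsBrownianMotion.isGaussianProcess_bridge {Ω : Type*} [MeasurableSpace Ω]
    {P : Measure Ω} [IsProbabilityMeasure P] {B : ℝ → Ω → ℝ} (hB : IsBrownianMotion P B) :
    IsGaussianProcess (Sum.elim (fun t : Icc (0:ℝ) 1 => bridgeResidual B t)
      fun _ : Unit => bridgeAverage B) P := by
  classical
  let e : Icc (0:ℝ) 1 := ⟨1, by simp⟩
  have havg (I : Finset (Option (Icc (0:ℝ) 1))) (h : none ∈ I) (he : some e ∈ I) :
      ∃ L : (I → ℝ) →L[ℝ] ℝ, ∀ ω, bridgeAverage B ω = L (I.restrict (withTimeAverage B · ω)) :=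
    ⟨.proj ⟨none, h⟩ - (1 / 2 : ℝ) • .proj ⟨some e, he⟩, fun ω => rfl⟩
  refine hB.isGaussianProcess_withTimeAverage.of_isGaussianProcess fun s => ?_
  cases s with
  | inr _ => exact ⟨{none, some e}, havg _ (by simp) (by simp)⟩
  | inl t =>
    obtain ⟨L, hL⟩ := havg {none, some e, some t} (by simp) (by simp)
    refine ⟨_, .proj ⟨some t, by simp⟩ - t.1 • .proj ⟨some e, by simp⟩
      - (6 * t.1 * (1 - t)) • L, fun ω => ?_⟩
    simp [bridgeResidual, hL, withTimeAverage, e]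

theorem IsBrownianMotion.indepFun_bridgeResidual_bridgeAverage {Ω : Type*} [MeasurableSpace Ω]
    {P : Measure Ω} [IsProbabilityMeasure P] {B : ℝ → Ω → ℝ} (hB : IsBrownianMotion P B) :
    IndepFun (fun ω (t : Icc (0:ℝ) 1) => bridgeResidual B t ω) (bridgeAverage B) P :=
  (hB.isGaussianProcess_bridge.indepFun_of_covariance_eq_zero
    (fun t => (hB.measurable_bridgeResidual t).aemeasurable)
    (fun _ => hB.measurable_bridgeAverage.aemeasurable)
    fun t _ => hB.covariance_bridgeResidual_bridgeAverage t.2).comp measurable_id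
      (measurable_pi_apply ())

theorem IsBrownianMotion.map_bridgeAverage {Ω : Type*} [MeasurableSpace Ω]
    {P : Measure Ω} [IsProbabilityMeasure P] {B : ℝ → Ω → ℝ} (hB : IsBrownianMotion P B) :
    P.map (bridgeAverage B) = gaussianReal 0 (1 / 12 : NNReal) := by
  have h1 : (1:ℝ) ∈ Icc (0:ℝ) 1 := by simp
  have hmean : ∫ ω, bridgeAverage B ω ∂P = 0 := by
    unfold bridgeAverage
    rw [integral_sub (hB.memLp_timeAverage.integrable one_le_two)
      (((hB.memLp_two h1).integrable one_le_two).const_mul _), integral_const_mul,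
      hB.integral_timeAverage, hB.integral_eq_zero h1]
    simp
  have hgauss : HasGaussianLaw (bridgeAverage B) P :=
    hB.isGaussianProcess_bridge.hasGaussianLaw_eval (.inr ())
  rw [hgauss.map_eq_gaussianReal, hmean, ← covariance_self hB.measurable_bridgeAverage.aemeasurable,
    hB.covariance_bridgeAverage_self]
  congr 1
  ext
  norm_num

/-- Integrating a bounded function of two independent variables, one variable at a time. -/
theorem ProbabilityTheory.IndepFun.integral_comp_prodMk {Ω E F : Type*} [MeasurableSpace Ω]
    [MeasurableSpace E] [MeasurableSpace F] {P : Measure Ω} [IsProbabilityMeasure P]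
    {X : Ω → E} {Y : Ω → F} (h : IndepFun X Y P) (hX : Measurable X) (hY : Measurable Y)
    {G : E × F → ℝ} (hG : Measurable G) {C : ℝ} (hC : ∀ z, |G z| ≤ C) :
    ∫ ω, G (X ω, Y ω) ∂P = ∫ y, (∫ ω, G (X ω, y) ∂P) ∂(P.map Y) := by
  have := Measure.isProbabilityMeasure_map (μ := P) hX.aemeasurable
  have := Measure.isProbabilityMeasure_map (μ := P) hY.aemeasurable
  rw [← integral_map (φ := fun ω => (X ω, Y ω)) (hX.prodMk hY).aemeasurable
      hG.aestronglyMeasurable,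
    (indepFun_iff_map_prod_eq_prod_map_map hX.aemeasurable hY.aemeasurable).1 h,
    integral_prod_symm _ (Integrable.of_bound hG.aestronglyMeasurable C (.of_forall hC))]
  refine integral_congr_ae (.of_forall fun y => ?_)
  exact integral_map hX.aemeasurable (hG.comp measurable_prodMk_right).aestronglyMeasurable

/-- The family of laws of `β^c_t = β_t + 6t(1-t)(c - ∫₀¹ β)`, `c ∈ ℝ`, is a regular
conditional distribution of the Brownian bridge `β` given its time average, which has
law `N(0, 1/12)`: for every bounded Borel `Φ` on paths and bounded Borel `f` on `ℝ`,
`E[Φ(β) f(∫₀¹ β)] = ∫ E[Φ(β^c)] f(c) N(0,1/12)(dc)`. -/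
theorem bridge_conditioned_on_average
    {Ω : Type*} [MeasurableSpace Ω] (P : Measure Ω) [IsProbabilityMeasure P]
    (B : ℝ → Ω → ℝ) (hB : IsBrownianMotion P B)
    (β : ℝ → Ω → ℝ) (hβ : ∀ t ω, β t ω = B t ω - t * B 1 ω)
    (βc : ℝ → ℝ → Ω → ℝ)
    (hβc : ∀ c t ω, βc c t ω
      = β t ω + 6 * t * (1 - t) * (c - ∫ r in (0:ℝ)..1, β r ω))
    (Φ : (Icc (0:ℝ) 1 → ℝ) → ℝ) (hΦ : Measurable Φ) (hΦb : ∃ C, ∀ x, |Φ x| ≤ C)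
    (f : ℝ → ℝ) (hf : Measurable f) (hfb : ∃ C, ∀ x, |f x| ≤ C) :
    ∫ ω, Φ (fun t => β t.1 ω) * f (∫ r in (0:ℝ)..1, β r ω) ∂P
      = ∫ c, (∫ ω, Φ (fun t => βc c t.1 ω) ∂P) * f c
          ∂(gaussianReal 0 (1/12 : NNReal)) := by
  obtain ⟨C, hC⟩ := hΦb
  obtain ⟨D, hD⟩ := hfb
  have hX (ω : Ω) : ∫ r in (0:ℝ)..1, β r ω = bridgeAverage B ω := by
    simp_rw [hβ]
    exact hB.intervalIntegral_bridge ω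
  let G (z : (Icc (0:ℝ) 1 → ℝ) × ℝ) : ℝ :=
    Φ (fun t => z.1 t + 6 * t.1 * (1 - t.1) * z.2) * f z.2
  have hG : Measurable G := by
    refine (hΦ.comp (measurable_pi_iff.2 fun t => ?_)).mul (hf.comp measurable_snd)
    exact ((measurable_pi_apply t).comp measurable_fst).add (measurable_snd.const_mul _)
  have hGb (z) : |G z| ≤ C * D := by
    rw [abs_mul]
    exact mul_le_mul (hC _) (hD _) (abs_nonneg _) ((abs_nonneg _).trans (hC 0))
  have key := hB.indepFun_bridgeResidual_bridgeAverage.integral_comp_prodMk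
    (measurable_pi_iff.2 fun t => hB.measurable_bridgeResidual t) hB.measurable_bridgeAverage
    hG hGb
  rw [hB.map_bridgeAverage] at key
  simp only [G, integral_mul_const] at key
  have hβ_eq (ω : Ω) : (fun t : Icc (0:ℝ) 1 => β t ω)
      = fun t : Icc (0:ℝ) 1 => bridgeResidual B t ω + 6 * t * (1 - t) * bridgeAverage B ω := by
    ext t
    rw [hβ, bridgeResidual]
    ring
  have hβc_eq (c : ℝ) (ω : Ω) : (fun t : Icc (0:ℝ) 1 => βc c t ω)
      = fun t : Icc (0:ℝ) 1 => bridgeResidual B t ω + 6 * t * (1 - t) * c := by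
    ext t
    rw [hβc, hβ, hX, bridgeResidual]
    ring
  simp_rw [hX, hβ_eq, hβc_eq]
  exact key
end

section
/- Let β be a Brownian bridge from 0 to 0 on [0,1], c ∈ ℝ, and β^c_t := β_t + 6 t(1−t)(c − ∫₀¹ β). For ω ∈ C([0,1]) define Γ^ω_t := ω_t for t ∈ [0,1/3] ∪ [2/3,1] and Γ^ω_t := ω_t + 18(9 t(1−t) − 2)(c − ∫₀¹ ω) for t ∈ [1/3,2/3], and ρ₁(ω) := √27 · exp( −162 ( ∫₀^{1/3} (ω_r + ω_{1−r}) dr + (ω_{1/3} + ω_{2/3})/6 − c )² + 6c² ). Then for every bounded Borel Φ : C([0,1]) → ℝ, E[Φ(β^c)] = E[Φ(Γ^β) ρ₁(Γ^β)]. -/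
open MeasureTheory ProbabilityTheory Set

section

open Filter Topology

theorem tendsto_riemann_sum {f : ℝ → ℝ} {a b : ℝ} (hab : a ≤ b) (hf : ContinuousOn f (Icc a b)) :
    Tendsto (fun n : ℕ => ∑ i ∈ Finset.range n, (b - a) / n * f (a + i * ((b - a) / n))) atTop
      (𝓝 (∫ x in a..b, f x)) := by
  have huc := isCompact_Icc.uniformContinuousOn_of_continuous hf
  rw [Metric.uniformContinuousOn_iff] at huc
  rw [Metric.tendsto_atTop]
  intro ε hε
  have hden : 0 < b - a + 1 := by linarith
  obtain ⟨δ, hδ, H⟩ := huc (ε / (b - a + 1)) (by positivity)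
  obtain ⟨N, hN⟩ := exists_nat_gt ((b - a) / δ)
  refine ⟨N + 1, fun n hn => ?_⟩
  have hn0 : (0 : ℝ) < n := by exact_mod_cast (show 0 < n by omega)
  have hNn : (N : ℝ) ≤ n := by exact_mod_cast (show N ≤ n by omega)
  set d := (b - a) / n with hd
  have hd0 : 0 ≤ d := div_nonneg (by linarith) hn0.le
  have hnd : n * d = b - a := by rw [hd]; field_simp
  have hdδ : d < δ := by
    rw [hd, div_lt_iff₀ hn0]
    rw [div_lt_iff₀ hδ] at hN
    nlinarith
  have hmem : ∀ i < n, ∀ x ∈ Icc (a + i * d) (a + (i + 1 : ℕ) * d), x ∈ Icc a b := by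
    intro i hi x hx
    have h1 : ((i + 1 : ℕ) : ℝ) ≤ n := by exact_mod_cast hi
    have h2 : (0 : ℝ) ≤ i * d := by positivity
    have h3 := mul_le_mul_of_nonneg_right h1 hd0
    exact ⟨by linarith [hx.1], by linarith [hx.2]⟩
  have hle : ∀ i : ℕ, a + i * d ≤ a + (i + 1 : ℕ) * d := fun i => by push_cast; linarith
  have hint : ∀ i < n, IntervalIntegrable f volume (a + i * d) (a + (i + 1 : ℕ) * d) :=
    fun i hi => (hf.mono fun x hx => hmem i hi x (by rwa [uIcc_of_le (hle i)] at hx)).intervalIntegrable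
  have hsum := intervalIntegral.sum_integral_adjacent_intervals (a := fun i : ℕ => a + i * d)
    (μ := volume) hint
  simp only [Nat.cast_zero, zero_mul, add_zero, hnd, add_sub_cancel] at hsum
  rw [← hsum, Real.dist_eq, ← Finset.sum_sub_distrib]
  have hterm : ∀ i ∈ Finset.range n,
      |d * f (a + i * d) - ∫ x in (a + i * d)..(a + (i + 1 : ℕ) * d), f x|
        ≤ ε / (b - a + 1) * d := by
    intro i hi
    have hi := Finset.mem_range.1 hi
    have h1 : d * f (a + i * d)
        = ∫ x in (a + i * d)..(a + (i + 1 : ℕ) * d), f (a + i * d) := by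
      rw [intervalIntegral.integral_const, smul_eq_mul]; push_cast; ring
    rw [h1, ← intervalIntegral.integral_sub (by simp) (hint i hi)]
    have := intervalIntegral.norm_integral_le_of_norm_le_const (C := ε / (b - a + 1))
      (a := a + i * d) (b := a + (i + 1 : ℕ) * d) (f := fun x => f (a + i * d) - f x) ?_
    · refine this.trans (le_of_eq ?_)
      congr 1
      rw [abs_of_nonneg (by linarith [hle i])]; push_cast; ring
    · intro x hx
      rw [uIoc_of_le (hle i)] at hx
      refine (H _ (hmem i hi _ ⟨le_rfl, hle i⟩) x (hmem i hi x ⟨hx.1.le, hx.2⟩) ?_).le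
      rw [dist_comm, Real.dist_eq, abs_of_nonneg (by linarith [hx.1])]
      have := hx.2
      push_cast at this
      linarith
  calc _ ≤ ∑ i ∈ Finset.range n, ε / (b - a + 1) * d :=
        (Finset.abs_sum_le_sum_abs _ _).trans (Finset.sum_le_sum hterm)
    _ = ε * ((b - a) / (b - a + 1)) := by
        rw [Finset.sum_const, Finset.card_range, nsmul_eq_mul, ← hnd]; ring
    _ < ε * 1 := by
        apply mul_lt_mul_of_pos_left _ hε
        rw [div_lt_one hden]; linarith
    _ = ε := mul_one ε

/-- The pointwise limits of sequences from a submodule of functions. -/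
def seqLimits {Ω : Type*} (S : Submodule ℝ (Ω → ℝ)) : Submodule ℝ (Ω → ℝ) where
  carrier := {X | ∃ u : ℕ → Ω → ℝ, (∀ n, u n ∈ S) ∧ Tendsto u atTop (𝓝 X)}
  zero_mem' := ⟨fun _ => 0, fun _ => S.zero_mem, tendsto_const_nhds⟩
  add_mem' := by
    rintro X Y ⟨u, hu, hu'⟩ ⟨w, hw, hw'⟩
    exact ⟨fun n => u n + w n, fun n => S.add_mem (hu n) (hw n), hu'.add hw'⟩
  smul_mem' := by
    rintro a X ⟨u, hu, hu'⟩
    exact ⟨fun n => a • u n, fun n => S.smul_mem a (hu n), hu'.const_smul a⟩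

theorem le_seqLimits {Ω : Type*} (S : Submodule ℝ (Ω → ℝ)) : S ≤ seqLimits S :=
  fun X hX => ⟨fun _ => X, fun _ => hX, tendsto_const_nhds⟩

section Gaussian

variable {Ω : Type*} [MeasurableSpace Ω] {P : Measure Ω}

theorem charFun_map_eq_integral {X : Ω → ℝ} (hX : Measurable X) (s : ℝ) :
    charFun (P.map X) s = ∫ ω, Complex.exp (s * X ω * Complex.I) ∂P := by
  rw [charFun_apply_real, integral_map hX.aemeasurable]
  exact Measurable.aestronglyMeasurable (by fun_prop)

theorem tendsto_integral_cexp [IsProbabilityMeasure P] {Y : ℕ → Ω → ℝ} {X : Ω → ℝ} (hY : ∀ n, Measurable (Y n))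
    (h : ∀ ω, Tendsto (Y · ω) atTop (𝓝 (X ω))) :
    Tendsto (fun n => ∫ ω, Complex.exp (Y n ω * Complex.I) ∂P) atTop
      (𝓝 (∫ ω, Complex.exp (X ω * Complex.I) ∂P)) := by
  refine tendsto_integral_of_dominated_convergence (fun _ => 1)
    (fun n => Measurable.aestronglyMeasurable (by have := hY n; fun_prop)) (integrable_const _)
    (fun n => ae_of_all _ fun ω => (Complex.norm_exp_ofReal_mul_I _).le)
    (ae_of_all _ fun ω => ?_)
  exact (Complex.continuous_exp.comp
    (Complex.continuous_ofReal.mul continuous_const)).continuousAt.tendsto.comp (h ω)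

theorem exists_gaussianReal_of_tendsto [IsProbabilityMeasure P] {Y : ℕ → Ω → ℝ} {X : Ω → ℝ}
    (hY : ∀ n, Measurable (Y n)) (hX : Measurable X)
    (hg : ∀ n, ∃ v : NNReal, P.map (Y n) = gaussianReal 0 v)
    (h : ∀ ω, Tendsto (Y · ω) atTop (𝓝 (X ω))) :
    ∃ v : NNReal, P.map X = gaussianReal 0 v := by
  choose v hv using hg
  have hconv : ∀ s : ℝ, Tendsto (fun n => Complex.exp (-(v n * s ^ 2 / 2 : ℝ))) atTop
      (𝓝 (charFun (P.map X) s)) := by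
    intro s
    rw [charFun_map_eq_integral hX]
    have h1 := tendsto_integral_cexp (P := P) (Y := fun n ω => s * Y n ω) (X := fun ω => s * X ω)
      (fun n => (hY n).const_mul s) (fun ω => (h ω).const_mul s)
    simp only [Complex.ofReal_mul] at h1
    refine h1.congr fun n => ?_
    rw [← charFun_map_eq_integral (hY n), hv n, charFun_gaussianReal]
    congr 1
    push_cast
    ring
  obtain ⟨s, hs0, hs⟩ : ∃ s : ℝ, s ≠ 0 ∧ charFun (P.map X) s ≠ 0 := by
    have h1 := tendsto_integral_cexp (P := P) (Y := fun n ω => ((n : ℝ) + 1)⁻¹ * X ω)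
      (X := fun _ => 0) (fun n => hX.const_mul _) (fun ω => by
        simpa using! (tendsto_one_div_add_atTop_nhds_zero_nat (𝕜 := ℝ)).mul_const (X ω))
    simp only [Complex.ofReal_zero, zero_mul, Complex.exp_zero, integral_const, probReal_univ,
      one_smul] at h1
    obtain ⟨n, hn⟩ := (h1.eventually_ne one_ne_zero).exists
    refine ⟨((n : ℝ) + 1)⁻¹, by positivity, ?_⟩
    rw [charFun_map_eq_integral hX]
    simpa only [Complex.ofReal_mul] using hn
  have hlim : Tendsto (fun n => (v n : ℝ)) atTop
      (𝓝 (-Real.log ‖charFun (P.map X) s‖ * 2 / s ^ 2)) := by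
    have h1 := ((hconv s).norm.log (norm_ne_zero_iff.2 hs)).neg.mul_const 2 |>.div_const (s ^ 2)
    refine h1.congr fun n => ?_
    rw [← Complex.ofReal_neg, Complex.norm_exp_ofReal, Real.log_exp]
    field_simp
  obtain ⟨w, hw⟩ := CanLift.prf (β := NNReal) _ (ge_of_tendsto' hlim fun n => (v n).2)
  rw [← hw] at hlim
  refine ⟨w, ?_⟩
  have := Measure.isProbabilityMeasure_map (μ := P) hX.aemeasurable
  refine Measure.ext_of_charFun (funext fun t => tendsto_nhds_unique (hconv t) ?_)
  rw [charFun_gaussianReal]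
  have h2 : Tendsto (fun n => Complex.exp (-(v n * t ^ 2 / 2 : ℝ))) atTop
      (𝓝 (Complex.exp (-(w * t ^ 2 / 2 : ℝ)))) :=
    (Complex.continuous_exp.comp Complex.continuous_ofReal.neg).continuousAt.tendsto.comp
      ((hlim.mul_const (t ^ 2)).div_const 2)
  convert h2 using 2
  congr 1
  push_cast
  simp

theorem centeredGaussian_of_mem_seqLimits [IsProbabilityMeasure P] {S : Submodule ℝ (Ω → ℝ)}
    (hS : ∀ X ∈ S, Measurable X ∧ ∃ v : NNReal, P.map X = gaussianReal 0 v)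
    {X : Ω → ℝ} (hX : X ∈ seqLimits S) :
    Measurable X ∧ ∃ v : NNReal, P.map X = gaussianReal 0 v := by
  obtain ⟨u, hu, hlim⟩ := hX
  have hm : Measurable X := measurable_of_tendsto_metrizable (fun n => (hS _ (hu n)).1) hlim
  exact ⟨hm, exists_gaussianReal_of_tendsto (fun n => (hS _ (hu n)).1) hm
    (fun n => (hS _ (hu n)).2) (tendsto_pi_nhds.1 hlim)⟩

theorem isGaussianProcess_of_mem {S : Submodule ℝ (Ω → ℝ)}
    (hS : ∀ X ∈ S, Measurable X ∧ ∃ v : NNReal, P.map X = gaussianReal 0 v)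
    {T : Type*} {Y : T → Ω → ℝ} (hY : ∀ t, Y t ∈ S) : IsGaussianProcess Y P where
  hasGaussianLaw I := by
    refine ⟨isGaussian_of_map_eq_gaussianReal fun L => ⟨0, ?_⟩⟩
    have hm : Measurable fun ω => I.restrict (Y · ω) :=
      measurable_pi_lambda _ fun i => (hS _ (hY i)).1
    rw [Measure.map_map L.continuous.measurable hm]
    refine (hS _ ?_).2
    classical
    have : (⇑L ∘ fun ω => I.restrict (Y · ω)) = ∑ i : I, L (Pi.single i 1) • Y i := by
      ext ω
      simp only [Function.comp, Finset.sum_apply, Pi.smul_apply, smul_eq_mul]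
      conv_lhs => rw [← Finset.univ_sum_single (I.restrict (Y · ω)), map_sum]
      refine Finset.sum_congr rfl fun i _ => ?_
      have : Pi.single i (I.restrict (Y · ω) i)
          = (Y i ω) • (Pi.single i 1 : I → ℝ) := by
        ext j; by_cases h : j = i
        · subst h; simp
        · simp [h]
      rw [this, map_smul, smul_eq_mul, mul_comm]
    rw [this]
    exact S.sum_mem fun i _ => S.smul_mem _ (hY i)

theorem memLp_two_of_map_eq_gaussianReal {X : Ω → ℝ} (hX : Measurable X) {v : NNReal}
    (h : P.map X = gaussianReal 0 v) : MemLp X 2 P := by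
  have : MemLp id 2 (P.map X) := h ▸ memLp_id_gaussianReal' 2 (by simp)
  exact (memLp_map_measure_iff (by fun_prop) hX.aemeasurable).1 this

theorem integral_eq_zero_of_map_eq_gaussianReal {X : Ω → ℝ} (hX : Measurable X) {v : NNReal}
    (h : P.map X = gaussianReal 0 v) : ∫ ω, X ω ∂P = 0 := by
  have := integral_id_gaussianReal (μ := 0) (v := v)
  rwa [← h, integral_map hX.aemeasurable (by fun_prop)] at this

theorem map_eq_gaussianReal_covariance {X : Ω → ℝ} (hX : Measurable X) {v : NNReal}
    (h : P.map X = gaussianReal 0 v) : P.map X = gaussianReal 0 (cov[X, X; P]).toNNReal := by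
  have := variance_id_gaussianReal (μ := 0) (v := v)
  rw [← h, variance_map aemeasurable_id hX.aemeasurable] at this
  rw [covariance_self hX.aemeasurable, ← Function.id_comp X, this]
  simpa using h

end Gaussian

theorem covariance_intervalIntegral_left {Ω : Type*} [MeasurableSpace Ω] {P : Measure Ω}
    [IsProbabilityMeasure P] {Z : ℝ → Ω → ℝ} {a b C : ℝ} {Y : Ω → ℝ} {φ : ℝ → ℝ} (hab : a ≤ b)
    (hZm : ∀ t, Measurable (Z t)) (hZc : ∀ ω, ContinuousOn (Z · ω) (Icc a b))
    (hZ2 : ∀ t ∈ Icc a b, MemLp (Z t) 2 P) (hZ0 : ∀ t ∈ Icc a b, P[Z t] = 0)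
    (hZC : ∀ t ∈ Icc a b, cov[Z t, Z t; P] ≤ C)
    (hYm : Measurable Y) (hY : MemLp Y 2 P) (hY0 : P[Y] = 0)
    (hI : MemLp (fun ω => ∫ t in a..b, Z t ω) 2 P)
    (hφ : ∀ t ∈ Icc a b, cov[Z t, Y; P] = φ t) :
    cov[fun ω => ∫ t in a..b, Z t ω, Y; P] = ∫ t in a..b, φ t := by
  have hcov : ∀ t ∈ Icc a b, ∫ ω, Z t ω * Y ω ∂P = φ t := by
    intro t ht
    rw [← hφ t ht, covariance_eq_sub (hZ2 t ht) hY, hY0, mul_zero, sub_zero]; rfl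
  set Z' : ℝ → Ω → ℝ := fun t => Z (projIcc a b hab t) with hZ'
  have hZ'eq : ∀ t ∈ Icc a b, Z' t = Z t := fun t ht => by rw [hZ']; simp [projIcc_of_mem hab ht]
  have hZ'c : ∀ ω, Continuous fun t => Z' t ω := fun ω =>
    (continuousOn_iff_continuous_domRestrict.1 (hZc ω)).comp continuous_projIcc
  have hZ'm : Measurable (Function.uncurry Z') :=
    measurable_uncurry_of_continuous_of_measurable hZ'c fun t => hZm _
  have hint : Integrable (Function.uncurry fun t ω => Z' t ω * Y ω)
      ((volume.restrict (Ioc a b)).prod P) := by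
    have hm : Measurable (Function.uncurry fun t ω => Z' t ω * Y ω) :=
      hZ'm.mul (hYm.comp measurable_snd)
    rw [integrable_prod_iff hm.aestronglyMeasurable]
    refine ⟨ae_of_all _ fun t => (hZ2 _ (projIcc a b hab t).2).integrable_mul hY, ?_⟩
    refine Integrable.of_bound hm.aestronglyMeasurable.norm.integral_prod_right'
      ((C + ∫ ω, Y ω ^ 2 ∂P) / 2) (ae_of_all _ fun t => ?_)
    have ht := (projIcc a b hab t).2
    have hsq : ∫ ω, Z' t ω ^ 2 ∂P ≤ C := by
      have := hZC _ ht
      rw [covariance_eq_sub (hZ2 _ ht) (hZ2 _ ht), hZ0 _ ht, mul_zero, sub_zero] at this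
      simpa [sq] using! this
    rw [Real.norm_of_nonneg (integral_nonneg fun _ => norm_nonneg _)]
    calc ∫ ω, ‖Z' t ω * Y ω‖ ∂P ≤ ∫ ω, (Z' t ω ^ 2 + Y ω ^ 2) / 2 ∂P := by
          refine integral_mono ((hZ2 _ ht).integrable_mul hY).norm
            (((hZ2 _ ht).integrable_sq.add hY.integrable_sq).div_const 2) fun ω => ?_
          simp only [Real.norm_eq_abs, abs_mul]
          nlinarith [sq_nonneg (|Z' t ω| - |Y ω|), sq_abs (Z' t ω), sq_abs (Y ω)]
      _ ≤ _ := by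
          rw [integral_div, integral_add (hZ2 _ ht).integrable_sq hY.integrable_sq]
          gcongr
  rw [covariance_eq_sub hI hY, hY0, mul_zero, sub_zero]
  have h1 : ∀ ω, ∫ t in a..b, Z t ω = ∫ t in Ioc a b, Z' t ω := fun ω => by
    rw [intervalIntegral.integral_of_le hab]
    exact setIntegral_congr_fun measurableSet_Ioc fun t ht => by
      simp only [hZ'eq t ⟨ht.1.le, ht.2⟩]
  calc _ = ∫ ω, (∫ t in Ioc a b, Z' t ω * Y ω) ∂P := by
        refine integral_congr_ae (ae_of_all _ fun ω => ?_)
        simp only [Pi.mul_apply, h1, integral_mul_const]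
    _ = ∫ t in Ioc a b, (∫ ω, Z' t ω * Y ω ∂P) := (integral_integral_swap hint).symm
    _ = _ := by
        rw [intervalIntegral.integral_of_le hab]
        refine setIntegral_congr_fun measurableSet_Ioc fun t ht => ?_
        simp only [hZ'eq t ⟨ht.1.le, ht.2⟩]
        exact hcov t ⟨ht.1.le, ht.2⟩

theorem integral_min_of_le {a b t : ℝ} (hab : a ≤ b) (h : t ≤ a) :
    ∫ s in a..b, min s t = t * (b - a) := by
  have : EqOn (fun s => min s t) (fun _ => t) (uIcc a b) := fun s hs => by
    rw [uIcc_of_le hab] at hs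
    exact min_eq_right (h.trans hs.1)
  rw [intervalIntegral.integral_congr this, intervalIntegral.integral_const, smul_eq_mul, mul_comm]

theorem integral_min_of_ge {a b t : ℝ} (hab : a ≤ b) (h : b ≤ t) :
    ∫ s in a..b, min s t = (b ^ 2 - a ^ 2) / 2 := by
  have : EqOn (fun s => min s t) (fun s => s) (uIcc a b) := fun s hs => by
    rw [uIcc_of_le hab] at hs
    exact min_eq_left (hs.2.trans h)
  rw [intervalIntegral.integral_congr this, integral_id]

theorem integral_min_of_mem {a b t : ℝ} (h : t ∈ Icc a b) :
    ∫ s in a..b, min s t = (t ^ 2 - a ^ 2) / 2 + t * (b - t) := by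
  have hc : Continuous fun s : ℝ => min s t := by fun_prop
  rw [← intervalIntegral.integral_add_adjacent_intervals (hc.intervalIntegrable a t)
    (hc.intervalIntegrable t b), integral_min_of_ge h.1 le_rfl, integral_min_of_le h.2 le_rfl]

theorem integral_min_sub_mul (a b t : ℝ) :
    ∫ s in a..b, (min s t - s * t) = (∫ s in a..b, min s t) - (b ^ 2 - a ^ 2) / 2 * t := by
  rw [intervalIntegral.integral_sub (Continuous.intervalIntegrable (by fun_prop) _ _)
    (Continuous.intervalIntegrable (by fun_prop) _ _), intervalIntegral.integral_mul_const,
    integral_id]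

theorem integral_mul_one_sub (a b : ℝ) :
    ∫ s in a..b, s * (1 - s) = (b ^ 2 - a ^ 2) / 2 - (b ^ 3 - a ^ 3) / 3 := by
  have : (fun s : ℝ => s * (1 - s)) = fun s => s - s ^ 2 := by ext; ring
  rw [this, intervalIntegral.integral_sub (Continuous.intervalIntegrable (by fun_prop) _ _)
    (Continuous.intervalIntegrable (by fun_prop) _ _), integral_id, integral_pow]
  norm_num

/-- The parabolic bump on `[1/3, 2/3]` with unit integral. -/
noncomputable def midBump (t : ℝ) : ℝ :=
  if t ∈ Icc (1 / 3 : ℝ) (2 / 3) then 18 * (9 * t * (1 - t) - 2) else 0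

/-- A centered Gaussian process on `[0,1]` with continuous paths and the covariance of the Brownian
bridge, such that its values and path integrals lie in a common space `S` of centered Gaussian
variables. -/
structure IsBridgeIn {Ω : Type*} [MeasurableSpace Ω] (P : Measure Ω) (S : Submodule ℝ (Ω → ℝ))
    (β : ℝ → Ω → ℝ) : Prop where
  gaussian : ∀ X ∈ S, Measurable X ∧ ∃ v : NNReal, P.map X = gaussianReal 0 v
  measurable : ∀ t, Measurable (β t)
  continuousOn : ∀ ω, ContinuousOn (β · ω) (Icc 0 1)
  mem : ∀ t ∈ Icc (0 : ℝ) 1, β t ∈ S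
  integral_mem : ∀ a ∈ Icc (0 : ℝ) 1, ∀ b ∈ Icc (0 : ℝ) 1, a ≤ b →
    (fun ω => ∫ r in a..b, β r ω) ∈ S
  cov : ∀ s ∈ Icc (0 : ℝ) 1, ∀ t ∈ Icc (0 : ℝ) 1, cov[β s, β t; P] = min s t - s * t

theorem IsBrownianMotion.isBridgeIn {Ω : Type*} [MeasurableSpace Ω] {P : Measure Ω}
    [IsProbabilityMeasure P] {B : ℝ → Ω → ℝ} (hB : IsBrownianMotion P B) {β : ℝ → Ω → ℝ}
    (hβ : ∀ t ω, β t ω = B t ω - t * B 1 ω) :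
    IsBridgeIn P (seqLimits (Submodule.span ℝ (B '' Icc 0 1))) β := by
  obtain ⟨hm, hc, hg, hcov⟩ := hB
  have hβ' : ∀ t, β t = B t - t • B 1 := fun t => funext fun ω => by simp [hβ]
  have h1 : (1 : ℝ) ∈ Icc (0 : ℝ) 1 := by simp
  have hspan : ∀ X ∈ Submodule.span ℝ (B '' Icc 0 1),
      Measurable X ∧ ∃ v : NNReal, P.map X = gaussianReal 0 v := by
    intro X hX
    obtain ⟨n, f, y, rfl⟩ := Submodule.mem_span_set'.1 hX
    choose t ht hty using fun i => (y i).2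
    have hsum : (∑ i, f i • (y i : Ω → ℝ)) = fun ω => ∑ i, f i * B (t i) ω := by
      ext ω; simp [← hty]
    rw [hsum]
    exact ⟨Finset.measurable_sum _ fun i _ => (hm _).const_mul _, hg n t ht f⟩
  have hBmem : ∀ t ∈ Icc (0 : ℝ) 1, B t ∈ Submodule.span ℝ (B '' Icc 0 1) :=
    fun t ht => Submodule.subset_span (mem_image_of_mem _ ht)
  have hβmem : ∀ t ∈ Icc (0 : ℝ) 1, β t ∈ Submodule.span ℝ (B '' Icc 0 1) := fun t ht => by
    rw [hβ']
    exact Submodule.sub_mem _ (hBmem t ht) (Submodule.smul_mem _ _ (hBmem 1 h1))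
  have hL2 : ∀ t ∈ Icc (0 : ℝ) 1, MemLp (B t) 2 P := fun t ht =>
    let ⟨hX, _, hv⟩ := hspan _ (hBmem t ht)
    memLp_two_of_map_eq_gaussianReal hX hv
  have hmean : ∀ t ∈ Icc (0 : ℝ) 1, P[B t] = 0 := fun t ht =>
    let ⟨hX, _, hv⟩ := hspan _ (hBmem t ht)
    integral_eq_zero_of_map_eq_gaussianReal hX hv
  have hBcov : ∀ s ∈ Icc (0 : ℝ) 1, ∀ t ∈ Icc (0 : ℝ) 1, cov[B s, B t; P] = min s t := by
    intro s hs t ht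
    rw [covariance_eq_sub (hL2 s hs) (hL2 t ht), hmean s hs, zero_mul, sub_zero]
    exact hcov s hs t ht
  have hβc : ∀ ω, ContinuousOn (β · ω) (Icc 0 1) := fun ω => by
    simp only [hβ]
    exact (hc ω).sub (by fun_prop)
  refine ⟨fun X hX => centeredGaussian_of_mem_seqLimits hspan hX, fun t => ?_, hβc,
    fun t ht => le_seqLimits _ (hβmem t ht), fun a ha b hb hab => ?_, fun s hs t ht => ?_⟩
  · rw [hβ']; exact (hm t).sub ((hm 1).const_smul t)
  · refine ⟨fun n => ∑ i ∈ Finset.range n, ((b - a) / n) • β (a + i * ((b - a) / n)), fun n => ?_,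
      tendsto_pi_nhds.2 fun ω => ?_⟩
    · refine Submodule.sum_mem _ fun i hi => Submodule.smul_mem _ _ (hβmem _ ?_)
      have hi : (i : ℝ) ≤ n := by exact_mod_cast (Finset.mem_range.1 hi).le
      have hn : (0 : ℝ) ≤ (b - a) / n := div_nonneg (by linarith) (by positivity)
      have h2 : i * ((b - a) / n) ≤ b - a := by
        rw [← mul_div_assoc]
        exact div_le_of_le_mul₀ (by positivity) (by linarith)
          (by rw [mul_comm]; exact mul_le_mul_of_nonneg_left hi (by linarith))
      have h3 : 0 ≤ i * ((b - a) / n) := by positivity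
      exact ⟨by linarith [ha.1], by linarith [hb.2]⟩
    · simpa using tendsto_riemann_sum hab ((hβc ω).mono (Icc_subset_Icc ha.1 hb.2))
  · have hs1 := (hL2 1 h1).const_smul s
    have ht1 := (hL2 1 h1).const_smul t
    rw [hβ', hβ', covariance_sub_sub (hL2 s hs) hs1 (hL2 t ht) ht1]
    simp only [covariance_smul_left, covariance_smul_right, hBcov s hs t ht, hBcov s hs 1 h1,
      hBcov 1 h1 t ht, hBcov 1 h1 1 h1, min_eq_left hs.2, min_eq_right ht.2, min_self]
    ring

namespace IsBridgeIn

variable {Ω : Type*} [MeasurableSpace Ω] {P : Measure Ω} {S : Submodule ℝ (Ω → ℝ)}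
  {β : ℝ → Ω → ℝ}

theorem memLp (h : IsBridgeIn P S β) {X : Ω → ℝ} (hX : X ∈ S) : MemLp X 2 P :=
  let ⟨hm, _, hv⟩ := h.gaussian X hX
  memLp_two_of_map_eq_gaussianReal hm hv

theorem integral_eq_zero (h : IsBridgeIn P S β) {X : Ω → ℝ} (hX : X ∈ S) : P[X] = 0 :=
  let ⟨hm, _, hv⟩ := h.gaussian X hX
  integral_eq_zero_of_map_eq_gaussianReal hm hv

theorem map_eq (h : IsBridgeIn P S β) {X : Ω → ℝ} (hX : X ∈ S) :
    P.map X = gaussianReal 0 (cov[X, X; P]).toNNReal :=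
  let ⟨hm, _, hv⟩ := h.gaussian X hX
  map_eq_gaussianReal_covariance hm hv

variable [IsProbabilityMeasure P]

theorem cov_integral (h : IsBridgeIn P S β) {a b : ℝ} (ha : a ∈ Icc (0 : ℝ) 1)
    (hb : b ∈ Icc (0 : ℝ) 1) (hab : a ≤ b) {Y : Ω → ℝ} (hY : Y ∈ S) {φ : ℝ → ℝ}
    (hφ : ∀ t ∈ Icc a b, cov[β t, Y; P] = φ t) :
    cov[fun ω => ∫ r in a..b, β r ω, Y; P] = ∫ t in a..b, φ t := by
  have hsub : Icc a b ⊆ Icc 0 1 := Icc_subset_Icc ha.1 hb.2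
  refine covariance_intervalIntegral_left (C := 1) hab h.measurable
    (fun ω => (h.continuousOn ω).mono hsub) (fun t ht => h.memLp (h.mem t (hsub ht)))
    (fun t ht => h.integral_eq_zero (h.mem t (hsub ht))) (fun t ht => ?_) (h.gaussian Y hY).1
    (h.memLp hY) (h.integral_eq_zero hY) (h.memLp (h.integral_mem a ha b hb hab)) hφ
  have ht := hsub ht
  rw [h.cov t ht t ht, min_self]
  nlinarith [ht.1, ht.2]

end IsBridgeIn

/-- The integral over `[1/3, 2/3]` of the deviation from the chord. -/
noncomputable def midArea {Ω : Type*} (β : ℝ → Ω → ℝ) : Ω → ℝ :=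
  (fun ω => ∫ r in (1 / 3 : ℝ)..(2 / 3), β r ω) - (1 / 6 : ℝ) • (β (1 / 3) + β (2 / 3))

/-- The total area under the path. -/
noncomputable def area {Ω : Type*} (β : ℝ → Ω → ℝ) : Ω → ℝ :=
  fun ω => ∫ r in (0 : ℝ)..1, β r ω

namespace IsBridgeIn

variable {Ω : Type*} [MeasurableSpace Ω] {P : Measure Ω} {S : Submodule ℝ (Ω → ℝ)}
  {β : ℝ → Ω → ℝ}

theorem area_mem (h : IsBridgeIn P S β) : area β ∈ S :=
  h.integral_mem 0 (by norm_num) 1 (by norm_num) zero_le_one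

theorem midArea_mem (h : IsBridgeIn P S β) : midArea β ∈ S :=
  S.sub_mem (h.integral_mem _ (by norm_num) _ (by norm_num) (by norm_num))
    (S.smul_mem _ (S.add_mem (h.mem _ (by norm_num)) (h.mem _ (by norm_num))))

variable [IsProbabilityMeasure P]

theorem cov_midArea_left (h : IsBridgeIn P S β) {Y : Ω → ℝ} (hY : Y ∈ S) {φ : ℝ → ℝ}
    (hφ : ∀ t ∈ Icc (1 / 3 : ℝ) (2 / 3), cov[β t, Y; P] = φ t) :
    cov[midArea β, Y; P]
      = (∫ t in (1 / 3 : ℝ)..(2 / 3), φ t) - (φ (1 / 3) + φ (2 / 3)) / 6 := by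
  have h1 := h.mem (1 / 3) (by norm_num)
  have h2 := h.mem (2 / 3) (by norm_num)
  rw [midArea, covariance_sub_left
    (h.memLp (h.integral_mem _ (by norm_num) _ (by norm_num) (by norm_num)))
    (h.memLp (S.smul_mem _ (S.add_mem h1 h2))) (h.memLp hY), covariance_smul_left,
    covariance_add_left (h.memLp h1) (h.memLp h2) (h.memLp hY),
    h.cov_integral (by norm_num) (by norm_num) (by norm_num) hY hφ,
    hφ _ (by norm_num), hφ _ (by norm_num)]
  ring

theorem cov_area (h : IsBridgeIn P S β) {t : ℝ} (ht : t ∈ Icc (0 : ℝ) 1) :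
    cov[β t, area β; P] = t * (1 - t) / 2 := by
  rw [covariance_comm]
  change cov[fun ω => ∫ r in (0 : ℝ)..1, β r ω, β t; P] = _
  rw [h.cov_integral (by norm_num) (by norm_num) zero_le_one (h.mem t ht)
    fun s hs => h.cov s hs t ht, integral_min_sub_mul, integral_min_of_mem ht]
  ring

theorem cov_midArea (h : IsBridgeIn P S β) {t : ℝ} (ht : t ∈ Icc (0 : ℝ) 1) :
    cov[β t, midArea β; P] = midBump t / 324 := by
  rw [covariance_comm, h.cov_midArea_left (h.mem t ht)
    fun s hs => h.cov s ⟨by linarith [hs.1], by linarith [hs.2]⟩ t ht, integral_min_sub_mul,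
    midBump]
  split_ifs with hmid
  · rw [integral_min_of_mem hmid, min_eq_left hmid.1, min_eq_right hmid.2]
    ring
  · rcases lt_or_ge t (1 / 3) with h1 | h1
    · rw [integral_min_of_le (by norm_num) h1.le, min_eq_right h1.le, min_eq_right (by linarith)]
      ring
    · have h2 : 2 / 3 < t := not_le.1 fun h2 => hmid ⟨h1, h2⟩
      rw [integral_min_of_ge (by norm_num) h2.le, min_eq_left h1, min_eq_left h2.le]
      ring

theorem cov_area_area (h : IsBridgeIn P S β) : cov[area β, area β; P] = 1 / 12 := by
  change cov[fun ω => ∫ r in (0 : ℝ)..1, β r ω, area β; P] = _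
  rw [h.cov_integral (by norm_num) (by norm_num) zero_le_one h.area_mem
    fun t ht => h.cov_area ht, intervalIntegral.integral_div, integral_mul_one_sub]
  norm_num

theorem cov_midArea_area (h : IsBridgeIn P S β) : cov[midArea β, area β; P] = 1 / 324 := by
  rw [h.cov_midArea_left h.area_mem
    fun t ht => h.cov_area ⟨by linarith [ht.1], by linarith [ht.2]⟩,
    intervalIntegral.integral_div, integral_mul_one_sub]
  norm_num

theorem cov_midArea_midArea (h : IsBridgeIn P S β) : cov[midArea β, midArea β; P] = 1 / 324 := by
  rw [h.cov_midArea_left (φ := fun t => (162 * (t * (1 - t)) - 36) / 324) h.midArea_mem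
    fun t ht => by
      rw [h.cov_midArea ⟨by linarith [ht.1], by linarith [ht.2]⟩, midBump, if_pos ht]; ring,
    intervalIntegral.integral_div, intervalIntegral.integral_sub
    (Continuous.intervalIntegrable (by fun_prop) _ _) (by simp),
    intervalIntegral.integral_const_mul, integral_mul_one_sub, intervalIntegral.integral_const]
  norm_num

theorem cov_comb_comb (h : IsBridgeIn P S β) (a b a' b' : ℝ) :
    cov[a • area β + b • midArea β, a' • area β + b' • midArea β; P]
      = a * a' / 12 + (a * b' + b * a' + b * b') / 324 := by
  have hX := h.memLp h.area_mem
  have hD := h.memLp h.midArea_mem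
  rw [covariance_add_left (hX.const_smul a) (hD.const_smul b)
    ((hX.const_smul a').add (hD.const_smul b')),
    covariance_add_right (hX.const_smul a) (hX.const_smul a') (hD.const_smul b'),
    covariance_add_right (hD.const_smul b) (hX.const_smul a') (hD.const_smul b')]
  simp only [covariance_smul_left, covariance_smul_right, h.cov_area_area, h.cov_midArea_area,
    covariance_comm (area β) (midArea β), h.cov_midArea_midArea]
  ring

theorem cov_comb (h : IsBridgeIn P S β) {t : ℝ} (ht : t ∈ Icc (0 : ℝ) 1) (a b : ℝ) :
    cov[β t, a • area β + b • midArea β; P] = a * (t * (1 - t) / 2) + b * (midBump t / 324) := by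
  have hX := h.memLp h.area_mem
  have hD := h.memLp h.midArea_mem
  rw [covariance_add_right (h.memLp (h.mem t ht)) (hX.const_smul a) (hD.const_smul b),
    covariance_smul_right, covariance_smul_right, h.cov_area ht, h.cov_midArea ht]

end IsBridgeIn

theorem integral_gaussianReal_tilt (c : ℝ) (f : ℝ → ℝ) :
    ∫ x, f x ∂gaussianReal (26 / 27 * c) (Real.toNNReal (13 / 4374))
      = ∫ x, f x * (√27 * Real.exp (-162 * (x - c) ^ 2 + 6 * c ^ 2))
          ∂gaussianReal 0 (Real.toNNReal (13 / 162)) := by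
  rw [integral_gaussianReal_eq_integral_smul (by simp),
    integral_gaussianReal_eq_integral_smul (by simp)]
  congr with x
  rw [gaussianPDFReal, gaussianPDFReal, Real.coe_toNNReal _ (by norm_num),
    Real.coe_toNNReal _ (by norm_num), smul_eq_mul, smul_eq_mul,
    show 2 * Real.pi * (13 / 162) = 27 * (2 * Real.pi * (13 / 4374)) by ring,
    Real.sqrt_mul (by norm_num : (0 : ℝ) ≤ 27)]
  have h27 : √27 ≠ 0 := by positivity
  have hexp : Real.exp (-(x - 26 / 27 * c) ^ 2 / (2 * (13 / 4374)))
      = Real.exp (-(x - 0) ^ 2 / (2 * (13 / 162)))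
        * Real.exp (-162 * (x - c) ^ 2 + 6 * c ^ 2) := by
    rw [← Real.exp_add]
    congr 1
    ring
  rw [hexp]
  field_simp

theorem integral_comp_of_indepFun {Ω E : Type*} [MeasurableSpace Ω] [MeasurableSpace E]
    {P : Measure Ω} [IsProbabilityMeasure P] {W : Ω → E} {A : Ω → ℝ} (hW : Measurable W)
    (hA : Measurable A) (hWA : IndepFun W A P) {f : E × ℝ → ℝ} (hf : Measurable f) {C : ℝ}
    (hC : ∀ x, |f x| ≤ C) :
    ∫ ω, f (W ω, A ω) ∂P = ∫ w, (∫ a, f (w, a) ∂P.map A) ∂P.map W := by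
  have := Measure.isProbabilityMeasure_map (μ := P) hW.aemeasurable
  have := Measure.isProbabilityMeasure_map (μ := P) hA.aemeasurable
  rw [← integral_prod f (Integrable.of_bound hf.aestronglyMeasurable C (ae_of_all _ hC)),
    ← (indepFun_iff_map_prod_eq_prod_map_map hW.aemeasurable hA.aemeasurable).1 hWA,
    integral_map (hW.prodMk hA).aemeasurable hf.aestronglyMeasurable]

namespace IsBridgeIn

variable {Ω : Type*} [MeasurableSpace Ω] {P : Measure Ω}
  {S : Submodule ℝ (Ω → ℝ)} {β : ℝ → Ω → ℝ}

/-- The regression coefficient of `β t` on `area β - midArea β`. -/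
noncomputable def outerBump (t : ℝ) : ℝ := (162 * (t * (1 - t)) - midBump t) / 26

/-- The part of the path that is uncorrelated with `area β` and `midArea β`. -/
noncomputable def residual {Ω : Type*} (β : ℝ → Ω → ℝ) (t : ℝ) : Ω → ℝ :=
  β t - ((outerBump t) • area β + (midBump t - outerBump t) • midArea β)

theorem residual_mem (h : IsBridgeIn P S β) {t : ℝ} (ht : t ∈ Icc (0 : ℝ) 1) :
    residual β t ∈ S :=
  S.sub_mem (h.mem t ht) (S.add_mem (S.smul_mem _ h.area_mem) (S.smul_mem _ h.midArea_mem))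

variable [IsProbabilityMeasure P]

theorem cov_residual_comb (h : IsBridgeIn P S β) {t : ℝ} (ht : t ∈ Icc (0 : ℝ) 1) (a b : ℝ) :
    cov[residual β t, a • area β + b • midArea β; P] = 0 := by
  have hcomb : ∀ a b : ℝ, MemLp (a • area β + b • midArea β) 2 P := fun a b =>
    ((h.memLp h.area_mem).const_smul a).add ((h.memLp h.midArea_mem).const_smul b)
  rw [residual, covariance_sub_left (h.memLp (h.mem t ht)) (hcomb _ _) (hcomb _ _),
    h.cov_comb ht, h.cov_comb_comb, outerBump]
  ring

theorem indepFun_residual_comb (h : IsBridgeIn P S β) (a b : ℝ) :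
    IndepFun (fun ω (t : Icc (0 : ℝ) 1) => residual β t ω) (a • area β + b • midArea β) P := by
  have hmem : a • area β + b • midArea β ∈ S :=
    S.add_mem (S.smul_mem _ h.area_mem) (S.smul_mem _ h.midArea_mem)
  have hind := (isGaussianProcess_of_mem h.gaussian
    (Y := Sum.elim (fun t : Icc (0 : ℝ) 1 => residual β t)
      (fun _ : Unit => a • area β + b • midArea β))
    (by rintro (t | _); exacts [h.residual_mem t.2, hmem])).indepFun_of_covariance_eq_zero
    (fun t => (h.gaussian _ (h.residual_mem t.2)).1.aemeasurable)
    (fun _ => (h.gaussian _ hmem).1.aemeasurable) (fun t _ => h.cov_residual_comb t.2 a b)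
  exact hind.comp measurable_id (measurable_pi_apply ())

theorem integral_conditioned_eq (h : IsBridgeIn P S β) (c : ℝ) {Φ : (Icc (0 : ℝ) 1 → ℝ) → ℝ}
    (hΦ : Measurable Φ) {C : ℝ} (hC : ∀ x, |Φ x| ≤ C) :
    ∫ ω, Φ (fun t => β t ω + 6 * t * (1 - t) * (c - area β ω)) ∂P
      = ∫ ω, Φ (fun t => β t ω + midBump t * (c - area β ω)) *
          (√27 * Real.exp (-162 * (area β ω - midArea β ω - c) ^ 2 + 6 * c ^ 2)) ∂P := by
  have hW : Measurable fun ω (t : Icc (0 : ℝ) 1) => residual β t ω :=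
    measurable_pi_lambda _ fun t => (h.gaussian _ (h.residual_mem t.2)).1
  have hmem : ∀ a b : ℝ, a • area β + b • midArea β ∈ S := fun a b =>
    S.add_mem (S.smul_mem _ h.area_mem) (S.smul_mem _ h.midArea_mem)
  have hA := (h.gaussian _ (hmem 1 (-1))).1
  have hA' := (h.gaussian _ (hmem (1 / 27) (-1))).1
  let F : (Icc (0 : ℝ) 1 → ℝ) × ℝ → Icc (0 : ℝ) 1 → ℝ := fun p t =>
    p.1 t + midBump t * c + (outerBump t - midBump t) * p.2
  have hF : Measurable F := measurable_pi_lambda _ fun t => by fun_prop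
  let G : (Icc (0 : ℝ) 1 → ℝ) × ℝ → ℝ := fun p =>
    Φ (F p) * (√27 * Real.exp (-162 * (p.2 - c) ^ 2 + 6 * c ^ 2))
  have hG : Measurable G := (hΦ.comp hF).mul (by fun_prop)
  have hρ : ∀ x : ℝ, |√27 * Real.exp (-162 * (x - c) ^ 2 + 6 * c ^ 2)|
      ≤ √27 * Real.exp (6 * c ^ 2) := fun x => by
    rw [abs_of_nonneg (by positivity)]
    gcongr
    nlinarith [sq_nonneg (x - c)]
  have hGC : ∀ x, |G x| ≤ C * (√27 * Real.exp (6 * c ^ 2)) := fun x =>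
    (abs_mul _ _).trans_le
      (mul_le_mul (hC _) (hρ _) (abs_nonneg _) ((abs_nonneg _).trans (hC 0)))
  have hbump : ∀ t, 26 * outerBump t = 162 * (t * (1 - t)) - midBump t := fun t => by
    rw [outerBump]; ring
  have hlaw : P.map (((1 : ℝ) • area β + (-1 : ℝ) • midArea β))
      = gaussianReal 0 (Real.toNNReal (13 / 162)) := by
    rw [h.map_eq (hmem _ _), h.cov_comb_comb]; norm_num
  have hlaw' : P.map (fun ω => 26 / 27 * c + ((1 / 27 : ℝ) • area β + (-1 : ℝ) • midArea β) ω)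
      = gaussianReal (26 / 27 * c) (Real.toNNReal (13 / 4374)) := by
    have := gaussianReal_map_const_add (μ := 0) (v := Real.toNNReal (13 / 4374)) (26 / 27 * c)
    rw [zero_add] at this
    rw [← this, show Real.toNNReal (13 / 4374) = (cov[(1 / 27 : ℝ) • area β + (-1 : ℝ) • midArea β,
      (1 / 27 : ℝ) • area β + (-1 : ℝ) • midArea β; P]).toNNReal by
        rw [h.cov_comb_comb]; norm_num, ← h.map_eq (hmem _ _),
      Measure.map_map (by fun_prop) hA']
    rfl
  have hl : ∀ ω, Φ (fun t => β t ω + 6 * t * (1 - t) * (c - area β ω))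
      = (Φ ∘ F) ((fun t => residual β t ω),
          26 / 27 * c + ((1 / 27 : ℝ) • area β + (-1 : ℝ) • midArea β) ω) := by
    intro ω
    simp only [Function.comp, F]
    congr 1
    ext t
    simp only [residual, Pi.add_apply, Pi.sub_apply, Pi.smul_apply, smul_eq_mul]
    linear_combination ((c - area β ω) / 27) * (-hbump t)
  have hr : ∀ ω, Φ (fun t => β t ω + midBump t * (c - area β ω)) *
        (√27 * Real.exp (-162 * (area β ω - midArea β ω - c) ^ 2 + 6 * c ^ 2))
      = G ((fun t => residual β t ω), ((1 : ℝ) • area β + (-1 : ℝ) • midArea β) ω) := by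
    intro ω
    simp only [F, G]
    congr 2
    · ext t
      simp only [residual, Pi.add_apply, Pi.sub_apply, Pi.smul_apply, smul_eq_mul]
      ring
    · simp only [Pi.add_apply, Pi.smul_apply, smul_eq_mul]
      ring_nf
  rw [integral_congr_ae (ae_of_all _ hl), integral_congr_ae (ae_of_all _ hr),
    integral_comp_of_indepFun hW (hA'.const_add _)
      ((h.indepFun_residual_comb _ _).comp measurable_id (measurable_const_add _)) (hΦ.comp hF)
      fun x => hC _,
    integral_comp_of_indepFun hW hA (h.indepFun_residual_comb _ _) hG hGC, hlaw, hlaw']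
  exact integral_congr_ae (ae_of_all _ fun w => integral_gaussianReal_tilt c _)

end IsBridgeIn

theorem integral_outer_of_eqOn {β γ : ℝ → ℝ} (hβ : ContinuousOn β (Icc 0 1))
    (h₁ : EqOn γ β (Icc 0 (1 / 3))) (h₂ : EqOn γ β (Icc (2 / 3) 1)) :
    (∫ r in (0 : ℝ)..(1 / 3), (γ r + γ (1 - r)))
      = (∫ r in (0 : ℝ)..1, β r) - ∫ r in (1 / 3 : ℝ)..(2 / 3), β r := by
  have hint : ∀ a ∈ Icc (0 : ℝ) 1, ∀ b ∈ Icc (0 : ℝ) 1, IntervalIntegrable β volume a b :=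
    fun a ha b hb => (hβ.mono (uIcc_subset_Icc ha hb)).intervalIntegrable
  have h0 := hint 0 (by norm_num) (1 / 3) (by norm_num)
  have h1 := hint (1 / 3) (by norm_num) (2 / 3) (by norm_num)
  have h2 := hint (2 / 3) (by norm_num) 1 (by norm_num)
  have h2' : IntervalIntegrable (fun r => β (1 - r)) volume 0 (1 / 3) := by
    refine ContinuousOn.intervalIntegrable (hβ.comp (by fun_prop) fun r hr => ?_)
    rw [uIcc_of_le (by norm_num)] at hr
    exact ⟨by linarith [hr.2], by linarith [hr.1]⟩
  have hcongr : EqOn (fun r => γ r + γ (1 - r)) (fun r => β r + β (1 - r)) (uIcc 0 (1 / 3)) := by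
    intro r hr
    rw [uIcc_of_le (by norm_num)] at hr
    simp only [h₁ hr, h₂ (show 1 - r ∈ Icc (2 / 3 : ℝ) 1 from
      ⟨by linarith [hr.2], by linarith [hr.1]⟩)]
  rw [intervalIntegral.integral_congr hcongr, intervalIntegral.integral_add h0 h2',
    intervalIntegral.integral_comp_sub_left, ← intervalIntegral.integral_add_adjacent_intervals
    h0 (h1.trans h2), ← intervalIntegral.integral_add_adjacent_intervals h1 h2]
  norm_num
  ring

theorem midBump_eq_zero {t : ℝ} (ht : t ≤ 1 / 3 ∨ 2 / 3 ≤ t) : midBump t = 0 := by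
  rw [midBump]
  split_ifs with h
  · rcases ht with ht | ht
    · rw [le_antisymm ht h.1]; norm_num
    · rw [le_antisymm h.2 ht]; norm_num
  · rfl

end

/-- Absolute continuity formula for the conditioned Brownian bridge:
`E[Φ(β^c)] = E[Φ(Γ^β) ρ₁(Γ^β)]` where `Γ^ω` agrees with `ω` on `[0,1/3] ∪ [2/3,1]`,
`Γ^ω_t = ω_t + 18(9t(1-t)-2)(c - ∫₀¹ ω)` on `[1/3,2/3]`, and
`ρ₁(ω) = √27 exp(-162(∫₀^{1/3}(ω_r + ω_{1-r})dr + (ω_{1/3}+ω_{2/3})/6 - c)² + 6c²)`. -/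
theorem bridge_conditioned_abs_continuity
    {Ω : Type*} [MeasurableSpace Ω] (P : Measure Ω) [IsProbabilityMeasure P]
    (B : ℝ → Ω → ℝ) (hB : IsBrownianMotion P B)
    (β : ℝ → Ω → ℝ) (hβ : ∀ t ω, β t ω = B t ω - t * B 1 ω)
    (c : ℝ) (βc : ℝ → Ω → ℝ)
    (hβc : ∀ t ω, βc t ω
      = β t ω + 6 * t * (1 - t) * (c - ∫ r in (0:ℝ)..1, β r ω))
    (Γ : ℝ → Ω → ℝ)
    (hΓ : ∀ t ω, Γ t ω =
      if t ∈ Icc (1/3 : ℝ) (2/3)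
        then β t ω + 18 * (9 * t * (1 - t) - 2) * (c - ∫ r in (0:ℝ)..1, β r ω)
        else β t ω)
    (Φ : (Icc (0:ℝ) 1 → ℝ) → ℝ) (hΦ : Measurable Φ) (hΦb : ∃ C, ∀ x, |Φ x| ≤ C) :
    ∫ ω, Φ (fun t => βc t.1 ω) ∂P
      = ∫ ω, Φ (fun t => Γ t.1 ω) *
          (Real.sqrt 27 *
            Real.exp (-162 *
              ((∫ r in (0:ℝ)..(1/3), (Γ r ω + Γ (1 - r) ω))
                + (Γ (1/3) ω + Γ (2/3) ω) / 6 - c) ^ 2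
              + 6 * c ^ 2)) ∂P := by
  obtain ⟨C, hC⟩ := hΦb
  have h := hB.isBridgeIn hβ
  have hΓ' : ∀ t ω, Γ t ω = β t ω + midBump t * (c - area β ω) := fun t ω => by
    rw [hΓ, midBump, area]
    split_ifs <;> ring
  have hΓβ : ∀ ω t, (t ≤ 1 / 3 ∨ 2 / 3 ≤ t) → Γ t ω = β t ω := fun ω t ht => by
    rw [hΓ', midBump_eq_zero ht, zero_mul, add_zero]
  have hA : ∀ ω, (∫ r in (0:ℝ)..(1/3), (Γ r ω + Γ (1 - r) ω)) + (Γ (1/3) ω + Γ (2/3) ω) / 6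
      = area β ω - midArea β ω := fun ω => by
    rw [integral_outer_of_eqOn (γ := (Γ · ω)) (h.continuousOn ω) (fun t ht => hΓβ ω t (.inl ht.2))
      (fun t ht => hΓβ ω t (.inr ht.1)), hΓβ ω _ (.inl le_rfl), hΓβ ω _ (.inr le_rfl)]
    simp only [area, midArea, Pi.sub_apply, Pi.smul_apply, Pi.add_apply, smul_eq_mul]
    ring
  simp only [hA]
  simp only [hβc, hΓ']
  exact h.integral_conditioned_eq c hΦ hC
end

section
/- Let 0 < δ ≤ T, let ζ be a finite signed measure on [δ,T] × [0,1], let v ∈ C([δ,T] × [0,1]) and c > 0. Assume: (i) for every s ∈ [δ,T] and every h ∈ C([0,1]) with ∫₀¹ h = 0, ∫_{[s,T]×[0,1]} h(θ) ζ(dt,dθ) = 0; (ii) for every s ∈ [δ,T], ∫₀¹ v(s,θ) dθ = c and ∫_{[s,T]×[0,1]} v dζ = 0. Then ζ ≡ 0. -/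
open MeasureTheory Set

/-- Integral of a real function on a set against a finite signed measure, via the
Jordan decomposition. -/
noncomputable def sintOn {α : Type*} [MeasurableSpace α]
    (ζ : MeasureTheory.SignedMeasure α) (S : Set α) (f : α → ℝ) : ℝ :=
  (∫ x in S, f x ∂ζ.toJordanDecomposition.posPart)
    - ∫ x in S, f x ∂ζ.toJordanDecomposition.negPart

/-- Finite measures on the plane are determined by the integrals over the half-planes
`[s,∞) × ℝ` of the bounded continuous functions of the second variable. -/
theorem ext_of_setIntegral_Ici_prod_univ {μ ν : Measure (ℝ × ℝ)}
    [IsFiniteMeasure μ] [IsFiniteMeasure ν]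
    (H : ∀ (s : ℝ) (h : BoundedContinuousFunction ℝ ℝ),
      ∫ p in Ici s ×ˢ univ, h p.2 ∂μ = ∫ p in Ici s ×ˢ univ, h p.2 ∂ν) : μ = ν := by
  have hsnd (s : ℝ) : (μ.restrict (Ici s ×ˢ univ)).snd = (ν.restrict (Ici s ×ˢ univ)).snd := by
    refine ext_of_forall_integral_eq_of_IsFiniteMeasure fun h => ?_
    rw [Measure.snd, Measure.snd, integral_map measurable_snd.aemeasurable
      h.continuous.aestronglyMeasurable, integral_map measurable_snd.aemeasurable
      h.continuous.aestronglyMeasurable]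
    exact H s h
  refine Measure.ext_prod fun {A B} hA hB => ?_
  have hfst : (μ.restrict (univ ×ˢ B)).fst = (ν.restrict (univ ×ˢ B)).fst := by
    refine Measure.ext_of_Ici _ _ fun s => ?_
    have hs := congrArg (fun m => m B) (hsnd s)
    simp only [Measure.snd_apply hB, Measure.fst_apply measurableSet_Ici,
      Measure.restrict_apply (measurable_snd hB),
      Measure.restrict_apply (measurable_fst (measurableSet_Ici (a := s)))] at hs ⊢
    have e : Prod.fst ⁻¹' Ici s ∩ (univ : Set ℝ) ×ˢ B = Prod.snd ⁻¹' B ∩ Ici s ×ˢ univ := by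
      ext ⟨x, y⟩; simp [and_comm]
    rw [e]; exact hs
  have hAB := congrArg (fun m => m A) hfst
  simp only [Measure.fst_apply hA, Measure.restrict_apply (measurable_fst hA)] at hAB
  have e : Prod.fst ⁻¹' A ∩ (univ : Set ℝ) ×ˢ B = A ×ˢ B := by
    ext ⟨x, y⟩; simp
  rwa [e] at hAB

/-- Restricting a measure carried by `[δ,T] × E` to a half-plane. -/
theorem restrict_Ici_prod_univ_of_compl_null {μ : Measure (ℝ × ℝ)} {δ T : ℝ} {E : Set ℝ}
    (hμ : μ (Icc δ T ×ˢ E)ᶜ = 0) (s : ℝ) :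
    μ.restrict (Ici s ×ˢ univ) = μ.restrict (Icc (max s δ) T ×ˢ E) := by
  refine Measure.restrict_congr_set ?_
  have hK : ∀ᵐ p ∂μ, p ∈ Icc δ T ×ˢ E := hμ
  filter_upwards [hK] with p hp
  refine propext ?_
  change p ∈ Ici s ×ˢ univ ↔ p ∈ Icc (max s δ) T ×ˢ E
  simp only [mem_prod, mem_Icc, mem_Ici, mem_univ, max_le_iff] at hp ⊢
  tauto

/-- The Jordan parts of a signed measure do not charge sets all of whose measurable subsets
have zero mass. -/
theorem posPart_negPart_eq_zero_of_forall_subset {α : Type*} [MeasurableSpace α]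
    {ζ : SignedMeasure α} {S : Set α} (hS : MeasurableSet S)
    (h : ∀ A ⊆ S, MeasurableSet A → ζ A = 0) :
    ζ.toJordanDecomposition.posPart S = 0 ∧ ζ.toJordanDecomposition.negPart S = 0 := by
  obtain ⟨i, hi, hpos, hneg, hp, hn⟩ := ζ.toJordanDecomposition_spec
  rw [hp, hn, SignedMeasure.toMeasureOfZeroLE_apply _ hpos hi hS,
    SignedMeasure.toMeasureOfLEZero_apply _ hneg hi.compl hS]
  have h₁ := h (i ∩ S) inter_subset_right (hi.inter hS)
  have h₂ := h (iᶜ ∩ S) inter_subset_right (hi.compl.inter hS)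
  constructor
  · rw [ENNReal.coe_eq_zero, ← NNReal.coe_eq_zero]; exact h₁
  · rw [ENNReal.coe_eq_zero, ← NNReal.coe_eq_zero]; simp [h₂]

/-- A finite signed measure annihilating the functions of zero average in the space variable
is a product with Lebesgue measure; written without subtraction. -/
theorem posPart_add_negPart_fst_prod_eq
    {δ T : ℝ} {ζ : SignedMeasure (ℝ × ℝ)}
    (hP : ζ.toJordanDecomposition.posPart (Icc δ T ×ˢ Icc (0:ℝ) 1)ᶜ = 0)
    (hN : ζ.toJordanDecomposition.negPart (Icc δ T ×ˢ Icc (0:ℝ) 1)ᶜ = 0)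
    (hzero : ∀ s ∈ Icc δ T, ∀ h : ℝ → ℝ, ContinuousOn h (Icc (0:ℝ) 1) →
      (∫ θ in (0:ℝ)..1, h θ) = 0 →
      sintOn ζ (Icc s T ×ˢ Icc (0:ℝ) 1) (fun p => h p.2) = 0) :
    ζ.toJordanDecomposition.posPart +
        ζ.toJordanDecomposition.negPart.fst.prod (volume.restrict (Icc (0:ℝ) 1)) =
      ζ.toJordanDecomposition.negPart +
        ζ.toJordanDecomposition.posPart.fst.prod (volume.restrict (Icc (0:ℝ) 1)) := by
  unfold sintOn at hzero
  set P := ζ.toJordanDecomposition.posPart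
  set N := ζ.toJordanDecomposition.negPart
  refine ext_of_setIntegral_Ici_prod_univ fun s h => ?_
  have h_integrable (μ : Measure (ℝ × ℝ)) [IsFiniteMeasure μ] :
      Integrable (fun p : ℝ × ℝ => h p.2) μ :=
    (h.compContinuous ⟨Prod.snd, continuous_snd⟩).integrable μ
  have hprod (ρ : Measure ℝ) [IsFiniteMeasure ρ] :
      ∫ p in Ici s ×ˢ univ, h p.2 ∂(ρ.prod (volume.restrict (Icc (0:ℝ) 1))) =
        ρ.real (Ici s) * ∫ θ in (0:ℝ)..1, h θ := by
    rw [← Measure.prod_restrict, Measure.restrict_univ, integral_fun_snd,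
      intervalIntegral.integral_of_le zero_le_one, integral_Icc_eq_integral_Ioc]
    simp
  have hfst (μ : Measure (ℝ × ℝ)) : μ.fst.real (Ici s) = μ.real (Ici s ×ˢ univ) := by
    rw [measureReal_def, Measure.fst_apply measurableSet_Ici, measureReal_def, prod_univ]
  have hsub (μ : Measure (ℝ × ℝ)) [IsFiniteMeasure μ] (m : ℝ) :
      ∫ p in Ici s ×ˢ univ, (h p.2 - m) ∂μ =
        ∫ p in Ici s ×ˢ univ, h p.2 ∂μ - μ.real (Ici s ×ˢ univ) * m := by
    rw [integral_sub (h_integrable _) (integrable_const _)]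
    simp
  have key : ∫ p in Ici s ×ˢ univ, (h p.2 - ∫ θ in (0:ℝ)..1, h θ) ∂P =
      ∫ p in Ici s ×ˢ univ, (h p.2 - ∫ θ in (0:ℝ)..1, h θ) ∂N := by
    rw [restrict_Ici_prod_univ_of_compl_null hP, restrict_Ici_prod_univ_of_compl_null hN]
    rcases le_or_gt (max s δ) T with hs | hs
    · refine sub_eq_zero.1 (hzero (max s δ) ⟨le_max_right _ _, hs⟩
        (fun θ => h θ - ∫ θ in (0:ℝ)..1, h θ) (by fun_prop) ?_)
      rw [intervalIntegral.integral_sub (h.continuous.intervalIntegrable _ _) (by simp)]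
      simp
    · simp [Icc_eq_empty_of_lt hs]
  rw [hsub, hsub] at key
  rw [Measure.restrict_add, integral_add_measure (h_integrable _) (h_integrable _), hprod, hfst,
    Measure.restrict_add, integral_add_measure (h_integrable _) (h_integrable _), hprod, hfst]
  linarith

/-- If a finite signed measure `ζ` on `[δ,T] × [0,1]` annihilates, on every
`[s,T] × [0,1]`, all continuous functions of the space variable with zero average,
and if `v` is continuous with space average `c > 0` at each time and
`∫_{[s,T]×[0,1]} v dζ = 0` for every `s`, then `ζ = 0`. -/
theorem signedMeasure_eq_zero_of_annihilates
    (δ T c : ℝ) (hδ : 0 < δ) (hδT : δ ≤ T) (hc : 0 < c)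
    (ζ : MeasureTheory.SignedMeasure (ℝ × ℝ))
    (hsupp : ∀ A : Set (ℝ × ℝ), MeasurableSet A →
      A ∩ (Icc δ T ×ˢ Icc (0:ℝ) 1) = ∅ → ζ A = 0)
    (v : ℝ × ℝ → ℝ) (hv : ContinuousOn v (Icc δ T ×ˢ Icc (0:ℝ) 1))
    (hzero : ∀ s ∈ Icc δ T, ∀ h : ℝ → ℝ, ContinuousOn h (Icc (0:ℝ) 1) →
      (∫ θ in (0:ℝ)..1, h θ) = 0 →
      sintOn ζ (Icc s T ×ˢ Icc (0:ℝ) 1) (fun p => h p.2) = 0)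
    (havg : ∀ s ∈ Icc δ T, (∫ θ in (0:ℝ)..1, v (s, θ)) = c)
    (hvint : ∀ s ∈ Icc δ T, sintOn ζ (Icc s T ×ˢ Icc (0:ℝ) 1) v = 0) :
    ζ = 0 := by
  obtain ⟨hP, hN⟩ := posPart_negPart_eq_zero_of_forall_subset (ζ := ζ)
    (measurableSet_Icc.prod measurableSet_Icc).compl
    fun A hA hAm => hsupp A hAm (disjoint_iff_inter_eq_empty.1
      (subset_compl_iff_disjoint_right.1 hA))
  have hprod := posPart_add_negPart_fst_prod_eq hP hN hzero
  have hζ := ζ.toSignedMeasure_toJordanDecomposition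
  rw [JordanDecomposition.toSignedMeasure] at hζ
  unfold sintOn at hvint
  set P := ζ.toJordanDecomposition.posPart
  set N := ζ.toJordanDecomposition.negPart
  have h_integrable (μ : Measure (ℝ × ℝ)) [IsFiniteMeasure μ] {s : ℝ} (hs : s ∈ Icc δ T) :
      IntegrableOn v (Icc s T ×ˢ Icc (0:ℝ) 1) μ :=
    (hv.integrableOn_compact (isCompact_Icc.prod isCompact_Icc)).mono_set
      (prod_mono (Icc_subset_Icc_left hs.1) subset_rfl)
  have hvprod (ρ : Measure ℝ) [IsFiniteMeasure ρ] {s : ℝ} (hs : s ∈ Icc δ T) :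
      ∫ p in Icc s T ×ˢ Icc (0:ℝ) 1, v p ∂(ρ.prod (volume.restrict (Icc (0:ℝ) 1))) =
        ρ.real (Icc s T) * c := by
    rw [setIntegral_prod _ (h_integrable _ hs), Measure.restrict_restrict measurableSet_Icc, inter_self,
      setIntegral_congr_fun (g := fun _ => c) measurableSet_Icc]
    · simp
    · intro t ht
      simp only
      rw [← havg t ⟨hs.1.trans ht.1, ht.2⟩, intervalIntegral.integral_of_le zero_le_one,
        integral_Icc_eq_integral_Ioc]
  have hIcc {s : ℝ} (hs : s ∈ Icc δ T) : P.fst (Icc s T) = N.fst (Icc s T) := by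
    have h₁ := congrArg (fun m => ∫ p in Icc s T ×ˢ Icc (0:ℝ) 1, v p ∂m) hprod
    simp only [Measure.restrict_add] at h₁
    rw [integral_add_measure (h_integrable _ hs) (h_integrable _ hs), hvprod _ hs,
      integral_add_measure (h_integrable _ hs) (h_integrable _ hs), hvprod _ hs] at h₁
    have h₂ := hvint s hs
    have h₃ : P.fst.real (Icc s T) = N.fst.real (Icc s T) :=
      mul_right_cancel₀ hc.ne' (by linarith)
    exact (measureReal_eq_measureReal_iff).1 h₃
  have hfst : P.fst = N.fst := by
    have hIci (μ : Measure (ℝ × ℝ)) (hμ : μ (Icc δ T ×ˢ Icc (0:ℝ) 1)ᶜ = 0) (s : ℝ) :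
        μ.fst (Ici s) = μ.fst (Icc (max s δ) T) := by
      rw [Measure.fst_apply measurableSet_Ici, Measure.fst_apply measurableSet_Icc]
      refine measure_congr ?_
      have hK : ∀ᵐ p ∂μ, p ∈ Icc δ T ×ˢ Icc (0:ℝ) 1 := hμ
      filter_upwards [hK] with p hp
      refine propext ?_
      change p.1 ∈ Ici s ↔ p.1 ∈ Icc (max s δ) T
      simp only [mem_prod, mem_Icc, mem_Ici, max_le_iff] at hp ⊢
      tauto
    refine Measure.ext_of_Ici _ _ fun s => ?_
    rw [hIci P hP, hIci N hN]
    rcases le_or_gt (max s δ) T with hs | hs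
    · exact hIcc ⟨le_max_right _ _, hs⟩
    · simp [Icc_eq_empty_of_lt hs]
  have hPN : P = N := by
    rw [hfst] at hprod
    exact (Measure.add_left_inj _ _ _).1 hprod
  rw [← hζ, sub_eq_zero]
  congr 1
end
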